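/- arXiv:2106.12418 — 6 statements merged into one kernel-verified Lean document; each statement's English description precedes it below -/
import Mathlib

section
/- Let X be a regular curve, f : X → X a monotone continuous map, and M an infinite minimal set of f. If M is connected, then the basin of attraction A(M) = {x ∈ X : ω_f(x) = M} is connected. -/
open Set Filter Metric Topology Function

/-- A regular curve: every point has arbitrarily small open neighborhoods
with finite topological boundary (to be used on a compact connected
nonempty metric space, i.e. a continuum). -/
def IsRegCurve (X : Type*) [TopologicalSpace X] : Prop :=
  ∀ (x : X) (V : Set X), IsOpen V → x ∈ V →
    ∃ U : Set X, IsOpen U ∧ x ∈ U ∧ U ⊆ V ∧ (frontier U).Finite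

/-- A monotone continuous self-map: continuous and preimages of connected
sets are connected. -/
def IsMonotoneMap {X : Type*} [TopologicalSpace X] (f : X → X) : Prop :=
  Continuous f ∧ ∀ C : Set X, IsPreconnected C → IsPreconnected (f ⁻¹' C)

/-- The ω-limit set of a point: ⋂ₙ closure {f^k(x) : k ≥ n}. -/
def omegaLimitSet {X : Type*} [TopologicalSpace X] (f : X → X) (x : X) : Set X :=
  ⋂ n : ℕ, closure ((fun k => f^[k] x) '' Set.Ici n)

/-- The α-limit set of a point: ⋂ₖ closure (⋃_{n ≥ k} f⁻ⁿ({x})). -/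
def alphaLimitSet {X : Type*} [TopologicalSpace X] (f : X → X) (x : X) : Set X :=
  ⋂ k : ℕ, closure (⋃ n ∈ Set.Ici k, f^[n] ⁻¹' {x})

/-- limsup of a sequence of sets: ⋂ₖ closure (⋃_{n ≥ k} G n). -/
def limsupSet {X : Type*} [TopologicalSpace X] (G : ℕ → Set X) : Set X :=
  ⋂ k : ℕ, closure (⋃ n ∈ Set.Ici k, G n)

/-- A minimal set of `f`: nonempty, closed, invariant, and with no proper
nonempty closed invariant subset. -/
def IsMinimalSet {X : Type*} [TopologicalSpace X] (f : X → X) (M : Set X) : Prop :=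
  M.Nonempty ∧ IsClosed M ∧ f '' M ⊆ M ∧
    ∀ A : Set X, A ⊆ M → A.Nonempty → IsClosed A → f '' A ⊆ A → A = M

/-- A periodic point of `f`. -/
def IsPeriodicPoint {X : Type*} (f : X → X) (x : X) : Prop :=
  ∃ n : ℕ, 1 ≤ n ∧ f^[n] x = x

/-- The set of limit (cluster) points of a sequence. -/
def seqLimitPoints {X : Type*} [TopologicalSpace X] (u : ℕ → X) : Set X :=
  {y : X | MapClusterPt y Filter.atTop u}


lemma meets_frontier {X : Type*} [TopologicalSpace X] {A U : Set X} (hA : IsPreconnected A)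
    (hU : IsOpen U) {a b : X} (ha : a ∈ A) (hb : b ∈ A) (haU : a ∈ U) (hbU : b ∉ U) :
    ∃ p ∈ A, p ∈ frontier U := by
  by_contra hne
  push Not at hne
  have := hA.subset_left_of_subset_union hU (isClosed_closure (s := U)).isOpen_compl
    (disjoint_compl_right.mono_left subset_closure) ?_ ⟨a, ha, haU⟩
  · exact hbU (this hb)
  · intro z hz
    by_cases hzU : z ∈ U
    · exact Or.inl hzU
    · right
      intro hzc
      exact hne z hz (by rw [hU.frontier_eq]; exact ⟨hzc, hzU⟩)

lemma null_family {X : Type*} [MetricSpace X] [CompactSpace X] (hX : IsRegCurve X)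
    {ι : Type*} (A : ι → Set X) (hA : ∀ i, IsPreconnected (A i))
    (hd : ∀ i j, i ≠ j → Disjoint (A i) (A j)) (ε : ℝ) (hε : 0 < ε) :
    {i | ∃ a ∈ A i, ∃ b ∈ A i, ε ≤ dist a b}.Finite := by
  classical
  choose U hUo hxU hUs hUf using fun x : X => hX x (ball x (ε / 2)) isOpen_ball
    (mem_ball_self (half_pos hε))
  obtain ⟨t, ht⟩ := isCompact_univ.elim_finite_subcover U hUo
    (fun x _ => mem_iUnion.2 ⟨x, hxU x⟩)
  have hΦ : (⋃ x ∈ t, frontier (U x)).Finite := t.finite_toSet.biUnion (fun x _ => hUf x)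
  have key : ∀ i : {i | ∃ a ∈ A i, ∃ b ∈ A i, ε ≤ dist a b},
      ∃ p ∈ ⋃ x ∈ t, frontier (U x), p ∈ A i := by
    rintro ⟨i, a, ha, b, hb, hab⟩
    obtain ⟨x, hxt, hax⟩ := mem_iUnion₂.1 (ht (mem_univ a))
    have hbx : b ∉ U x := by
      intro hbx
      have h1 := hUs x hax
      have h2 := hUs x hbx
      rw [mem_ball] at h1 h2
      have := dist_triangle_right a b x
      linarith
    obtain ⟨p, hp, hpf⟩ := meets_frontier (hA i) (hUo x) ha hb hax hbx
    exact ⟨p, mem_iUnion₂.2 ⟨x, hxt, hpf⟩, hp⟩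
  choose p hp hpA using key
  have := hΦ.to_subtype
  have : Finite {i | ∃ a ∈ A i, ∃ b ∈ A i, ε ≤ dist a b} := by
    refine Finite.of_injective (fun i => (⟨p i, hp i⟩ : ↥(⋃ x ∈ t, frontier (U x)))) ?_
    intro i j hij
    have hij' : p i = p j := congrArg Subtype.val hij
    by_contra hne
    have := hd i j (fun h => hne (Subtype.ext h))
    exact Set.disjoint_left.1 this (hpA i) (hij' ▸ hpA j)
  exact Set.toFinite _

lemma iter_pre {X : Type*} [TopologicalSpace X] {f : X → X} (hf : IsMonotoneMap f) (n : ℕ)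
    {C : Set X} (hC : IsPreconnected C) : IsPreconnected (f^[n] ⁻¹' C) := by
  induction n generalizing C with
  | zero => simpa using hC
  | succ n ih =>
    rw [Function.iterate_succ, Set.preimage_comp]
    exact hf.2 _ (ih hC)

lemma exists_minimal {Z : Type*} [TopologicalSpace Z] [CompactSpace Z] (g : Z → Z)
    (S : Set Z) (hS : S.Nonempty) (hc : IsClosed S) (hi : g '' S ⊆ S) :
    ∃ N, N ⊆ S ∧ IsMinimalSet g N := by
  have H : ∀ c ⊆ {A : Set Z | A.Nonempty ∧ IsClosed A ∧ g '' A ⊆ A}, IsChain (· ⊆ ·) c →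
      c.Nonempty → ∃ lb ∈ {A : Set Z | A.Nonempty ∧ IsClosed A ∧ g '' A ⊆ A},
        ∀ s ∈ c, lb ⊆ s := by
    intro c hc hch hne
    refine ⟨⋂₀ c, ⟨?_, isClosed_sInter fun s hs => (hc hs).2.1, ?_⟩,
      fun s hs => sInter_subset_of_mem hs⟩
    · have := hne.to_subtype
      refine IsCompact.nonempty_sInter_of_directed_nonempty_isCompact_isClosed ?_ ?_ ?_ ?_
      · intro s hs t ht
        rcases hch.total hs ht with h | h
        · exact ⟨s, hs, le_rfl, h⟩
        · exact ⟨t, ht, h, le_rfl⟩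
      · exact fun s hs => (hc hs).1
      · exact fun s hs => (hc hs).2.1.isCompact
      · exact fun s hs => (hc hs).2.1
    · rintro _ ⟨x, hx, rfl⟩ s hs
      exact (hc hs).2.2 ⟨x, hx s hs, rfl⟩
  obtain ⟨N, hNS, hN⟩ := zorn_superset_nonempty _ H S ⟨hS, hc, hi⟩
  refine ⟨N, hNS, hN.prop.1, hN.prop.2.1, hN.prop.2.2, ?_⟩
  intro A hA h1 h2 h3
  exact (hN.eq_of_subset ⟨h1, h2, h3⟩ hA)

lemma loc_conn {X : Type*} [MetricSpace X] [CompactSpace X] [ConnectedSpace X]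
    (hX : IsRegCurve X) : LocallyConnectedSpace X := by
  rw [locallyConnectedSpace_iff_connected_subsets]
  intro x V hV
  obtain ⟨V', hV', hV'c, hV'V⟩ : ∃ V' : Set X, x ∈ V' ∧ IsOpen V' ∧ closure V' ⊆ V := by
    obtain ⟨ε, hε, h⟩ := Metric.mem_nhds_iff.1 hV
    refine ⟨ball x (ε/2), mem_ball_self (half_pos hε), isOpen_ball, ?_⟩
    exact (closure_ball_subset_closedBall).trans ((closedBall_subset_ball (by linarith)).trans h)
  obtain ⟨U, hUo, hxU, hUV, hUf⟩ := hX x V' hV'c hV'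
  set K : Set X := closure U with hK
  have hKc : IsCompact K := isClosed_closure.isCompact
  have : CompactSpace K := isCompact_iff_compactSpace.1 hKc
  let x' : K := ⟨x, subset_closure hxU⟩
  let D : Set K := connectedComponent x'
  have hD : D = ⋂ s : { s : Set K // IsClopen s ∧ x' ∈ s }, s := connectedComponent_eq_iInter_isClopen x'
  -- separate boundary points
  have hsep : ∀ p : K, p ∉ D → ∃ A : Set K, IsClopen A ∧ x' ∈ A ∧ p ∉ A := by
    intro p hp
    rw [hD, mem_iInter] at hp
    push Not at hp
    obtain ⟨⟨s, hs⟩, hps⟩ := hp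
    exact ⟨s, hs.1, hs.2, hps⟩
  have hsep' : ∀ p : K, ∃ A : Set K, IsClopen A ∧ x' ∈ A ∧ (p ∉ D → p ∉ A) := by
    intro p
    by_cases h : p ∈ D
    · exact ⟨univ, isClopen_univ, mem_univ _, fun h' => absurd h h'⟩
    · obtain ⟨A, h1, h2, h3⟩ := hsep p h
      exact ⟨A, h1, h2, fun _ => h3⟩
  choose A hAc hxA hpA using hsep'
  let B : Set K := {p | (p : X) ∈ frontier U}
  have hB : B.Finite := hUf.preimage Subtype.val_injective.injOn
  let A0 : Set K := ⋂ p ∈ B, A p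
  have hA0 : IsClopen A0 := hB.isClopen_biInter fun p _ => hAc p
  have hxA0 : x' ∈ A0 := mem_iInter₂.2 fun p _ => hxA p
  have hsub : A0 ⊆ D := by
    intro z hz
    by_contra hzD
    obtain ⟨E, hE, hxE, hzE⟩ := hsep z hzD
    have hDE : D ⊆ E := by rw [hD]; exact iInter_subset (fun s : { s : Set K // IsClopen s ∧ x' ∈ s } => (s : Set K)) ⟨E, hE, hxE⟩
    let Q : Set K := A0 ∩ Eᶜ
    have hQ : IsClopen Q := hA0.inter hE.compl
    have hQU : ∀ q ∈ Q, (q : X) ∈ U := by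
      intro q hq
      by_contra hqU
      have hqB : q ∈ B := by
        change (q : X) ∈ frontier U
        rw [hUo.frontier_eq]; exact ⟨q.2, hqU⟩
      have h1 : q ∈ A q := mem_iInter₂.1 hq.1 q hqB
      have h2 : q ∉ D := fun h => hq.2 (hDE h)
      exact hpA q h2 h1
    have hQcl : IsClosed (Subtype.val '' Q : Set X) :=
      hKc.isClosed.isClosedEmbedding_subtypeVal.isClosedMap _ hQ.1
    have hQop : IsOpen (Subtype.val '' Q : Set X) := by
      obtain ⟨T, hT, hTQ⟩ := isOpen_induced_iff.1 hQ.2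
      have : (Subtype.val '' Q : Set X) = T ∩ U := by
        ext y
        constructor
        · rintro ⟨q, hq, rfl⟩
          refine ⟨?_, hQU q hq⟩
          rw [← hTQ] at hq; exact hq
        · rintro ⟨h1, h2⟩
          refine ⟨⟨y, subset_closure h2⟩, ?_, rfl⟩
          rw [← hTQ]; exact h1
      rw [this]; exact hT.inter hUo
    rcases isClopen_iff.1 (⟨hQcl, hQop⟩ : IsClopen (Subtype.val '' Q : Set X)) with h | h
    · have : (z : X) ∈ (Subtype.val '' Q : Set X) := ⟨z, ⟨hz, hzE⟩, rfl⟩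
      rw [h] at this; exact this
    · have : x ∈ (Subtype.val '' Q : Set X) := by rw [h]; trivial
      obtain ⟨q, hq, hqx⟩ := this
      have : q = x' := Subtype.ext hqx
      rw [this] at hq
      exact hq.2 hxE
  refine ⟨Subtype.val '' D, ?_, ?_, ?_⟩
  · have h1 : D ∈ 𝓝 x' := mem_of_superset (hA0.2.mem_nhds hxA0) hsub
    have h2 : K ∈ 𝓝 x := mem_of_superset (hUo.mem_nhds hxU) subset_closure
    have := (mem_nhds_subtype K x' D).1 h1
    obtain ⟨u, hu, huD⟩ := this
    refine mem_of_superset (inter_mem hu h2) ?_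
    rintro y ⟨hy1, hy2⟩
    exact ⟨⟨y, hy2⟩, huD hy1, rfl⟩
  · exact isPreconnected_connectedComponent.image _ continuous_subtype_val.continuousOn
  · rintro _ ⟨q, _, rfl⟩
    exact hV'V (closure_mono hUV q.2)

lemma chain_lemma {X : Type*} [MetricSpace X] [LocallyConnectedSpace X] [CompactSpace X]
    {O : Set X} (hO : IsOpen O) (hp : IsPreconnected O) {a b : X} (ha : a ∈ O) (hb : b ∈ O) :
    ∃ C : Set X, IsCompact C ∧ IsPreconnected C ∧ C ⊆ O ∧ a ∈ C ∧ b ∈ C := by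
  let R : Set X := {z | ∃ C : Set X, IsCompact C ∧ IsPreconnected C ∧ C ⊆ O ∧ a ∈ C ∧ z ∈ C}
  have hloc : ∀ z ∈ O, ∃ W ∈ 𝓝 z, IsCompact W ∧ IsPreconnected W ∧ W ⊆ O := by
    intro z hz
    obtain ⟨ε, hε, h⟩ := Metric.mem_nhds_iff.1 (hO.mem_nhds hz)
    obtain ⟨W, hW, hWc, hWs⟩ := locallyConnectedSpace_iff_connected_subsets.1 inferInstance z
      (ball z (ε/2)) (ball_mem_nhds z (half_pos hε))
    refine ⟨closure W, mem_of_superset hW subset_closure, isClosed_closure.isCompact, hWc.closure, ?_⟩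
    exact (closure_mono hWs).trans ((closure_ball_subset_closedBall).trans
      ((closedBall_subset_ball (by linarith)).trans h))
  have hcomb : ∀ z ∈ O, ∃ W ∈ 𝓝 z, ∀ y ∈ W, y ∈ R → W ⊆ R := by
    intro z hz
    obtain ⟨W, hW, hWk, hWp, hWO⟩ := hloc z hz
    refine ⟨W, hW, ?_⟩
    rintro y hy ⟨C, hC, hCp, hCO, haC, hyC⟩ w hw
    exact ⟨C ∪ W, hC.union hWk, hCp.union y hyC hy hWp, union_subset hCO hWO, Or.inl haC, Or.inr hw⟩
  have haR : a ∈ R := ⟨{a}, isCompact_singleton, isPreconnected_singleton, by simpa using ha, rfl, rfl⟩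
  have hRO : R ⊆ O := by rintro z ⟨C, _, _, h, _, hz⟩; exact h hz
  have hRo : IsOpen R := by
    rw [isOpen_iff_mem_nhds]
    intro z hz
    obtain ⟨W, hW, h⟩ := hcomb z (hRO hz)
    exact mem_of_superset hW (h z (mem_of_mem_nhds hW) hz)
  have hRo' : IsOpen (O \ R) := by
    rw [isOpen_iff_mem_nhds]
    intro z hz
    obtain ⟨W, hW, h⟩ := hcomb z hz.1
    refine mem_of_superset (inter_mem hW (hO.mem_nhds hz.1)) ?_
    rintro y ⟨hy, hyO⟩
    exact ⟨hyO, fun hyR => hz.2 (h y hy hyR (mem_of_mem_nhds hW))⟩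
  have := hp.subset_left_of_subset_union hRo hRo' disjoint_sdiff_right
    (by intro z hz; by_cases h : z ∈ R; exacts [Or.inl h, Or.inr ⟨hz, h⟩]) ⟨a, ha, haR⟩
  exact this hb

lemma inv_iter {X : Type*} {f : X → X} {M : Set X} (h : f '' M ⊆ M) (n : ℕ) {x : X} (hx : x ∈ M) :
    f^[n] x ∈ M := by
  induction n with
  | zero => exact hx
  | succ n ih =>
    rw [Function.iterate_succ_apply']
    exact h ⟨_, ih, rfl⟩

lemma total_min {X : Type*} [MetricSpace X] [CompactSpace X] {f : X → X} (hf : Continuous f)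
    {M : Set X} (hM : IsMinimalSet f M) (hMc : IsConnected M) {l : ℕ} (hl : 1 ≤ l)
    {N : Set X} (hNM : N ⊆ M) (hN : N.Nonempty) (hNc : IsClosed N)
    (hNi : ∀ x ∈ N, f^[l] x ∈ N) : N = M := by
  obtain ⟨N0, hN0, hmin⟩ := exists_minimal (f^[l]) N hN hNc (by rintro _ ⟨x, hx, rfl⟩; exact hNi x hx)
  obtain ⟨⟨p, hp⟩, hcl, hinv, hmi⟩ := hmin
  have hit : ∀ i, Continuous (f^[i]) := fun i => hf.iterate i
  have hcomm : ∀ i x, f^[l] (f^[i] x) = f^[i] (f^[l] x) := fun i x => by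
    rw [← Function.iterate_add_apply, ← Function.iterate_add_apply, add_comm]
  have himc : ∀ i, IsClosed (f^[i] '' N0) := fun i => (hcl.isCompact.image (hit i)).isClosed
  have himi : ∀ i, ∀ x ∈ f^[i] '' N0, f^[l] x ∈ f^[i] '' N0 := by
    rintro i _ ⟨x, hx, rfl⟩
    rw [hcomm]
    exact ⟨_, hinv ⟨x, hx, rfl⟩, rfl⟩
  have hdich : ∀ i, Disjoint (f^[i] '' N0) N0 ∨ f^[i] '' N0 ⊆ N0 := by
    intro i
    rw [or_iff_not_imp_left, Set.not_disjoint_iff]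
    rintro ⟨z, hz1, hz2⟩
    obtain ⟨w, hw, hwz⟩ := hz1
    have hE : N0 ∩ f^[i] ⁻¹' N0 = N0 := by
      apply hmi _ inter_subset_left ⟨w, hw, by rw [mem_preimage, hwz]; exact hz2⟩
        (hcl.inter (hcl.preimage (hit i)))
      rintro _ ⟨x, hx, rfl⟩
      refine ⟨hinv ⟨x, hx.1, rfl⟩, ?_⟩
      rw [mem_preimage, ← hcomm]
      exact hinv ⟨_, hx.2, rfl⟩
    rintro _ ⟨x, hx, rfl⟩
    rw [← hE] at hx
    exact hx.2
  have hun : (⋃ i ∈ Finset.range l, f^[i] '' N0) = M := by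
    apply hM.2.2.2
    · apply iUnion₂_subset
      rintro i _ _ ⟨x, hx, rfl⟩
      exact inv_iter hM.2.2.1 i (hNM (hN0 hx))
    · exact ⟨p, mem_iUnion₂.2 ⟨0, Finset.mem_range.2 hl, p, hp, rfl⟩⟩
    · exact (Finset.range l).finite_toSet.isClosed_biUnion fun i _ => himc i
    · rintro _ ⟨_, hy, rfl⟩
      obtain ⟨i, hi, x, hx, rfl⟩ := mem_iUnion₂.1 hy
      rw [Finset.mem_range] at hi
      rw [← Function.iterate_succ_apply' f i x]
      by_cases h : i + 1 < l
      · exact mem_iUnion₂.2 ⟨i + 1, Finset.mem_range.2 h, x, hx, rfl⟩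
      · have h2 : i.succ = l := by omega
        rw [h2]
        exact mem_iUnion₂.2 ⟨0, Finset.mem_range.2 hl, _, hinv ⟨x, hx, rfl⟩, rfl⟩
  classical
  let J := (Finset.range l).filter (fun i => Disjoint (f^[i] '' N0) N0)
  have hP := isPreconnected_iff_subset_of_disjoint_closed.1 hMc.isPreconnected N0
    (⋃ i ∈ J, f^[i] '' N0) hcl (J.finite_toSet.isClosed_biUnion fun i _ => himc i) (by
      intro z hz
      rw [← hun] at hz
      obtain ⟨i, hi, hzi⟩ := mem_iUnion₂.1 hz
      rcases hdich i with h | h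
      · exact Or.inr (mem_iUnion₂.2 ⟨i, Finset.mem_filter.2 ⟨hi, h⟩, hzi⟩)
      · exact Or.inl (h hzi)) (by
      rw [Set.eq_empty_iff_forall_notMem]
      rintro z ⟨_, hz, hz2⟩
      obtain ⟨i, hi, hzi⟩ := mem_iUnion₂.1 hz2
      exact Set.disjoint_left.1 (Finset.mem_filter.1 hi).2 hzi hz)
  rcases hP with h | h
  · exact hNM.antisymm (h.trans hN0)
  · obtain ⟨i, hi, hzi⟩ := mem_iUnion₂.1 (h (hNM (hN0 hp)))
    exact absurd hp (Set.disjoint_left.1 (Finset.mem_filter.1 hi).2 hzi)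

lemma no_periodic {X : Type*} [MetricSpace X] [CompactSpace X] {f : X → X} (hf : Continuous f)
    {M : Set X} (hM : IsMinimalSet f M) (hMc : IsConnected M) (hMinf : M.Infinite)
    {q : X} (hq : q ∈ M) (hp : IsPeriodicPoint f q) : False := by
  obtain ⟨l, hl, h⟩ := hp
  have := total_min hf hM hMc hl (N := {q}) (by simpa using hq) (singleton_nonempty q)
    isClosed_singleton (by rintro x rfl; exact h)
  rw [← this] at hMinf
  exact hMinf (finite_singleton q)

def RR {X : Type*} (f : X → X) (q : X) : Set X := {y | ∃ L, 1 ≤ L ∧ f^[L] q = q ∧ f^[L] y = q}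

lemma RR_pre {X : Type*} [TopologicalSpace X] {f : X → X} (hf : IsMonotoneMap f) (q : X) :
    IsPreconnected (RR f q) := by
  apply isPreconnected_of_forall q
  rintro y ⟨L, hL, h1, h2⟩
  exact ⟨f^[L] ⁻¹' {q}, fun z hz => ⟨L, hL, h1, hz⟩, h1, h2, iter_pre hf L isPreconnected_singleton⟩

lemma per_mul {X : Type*} {f : X → X} {q : X} {L : ℕ} (h : f^[L] q = q) (k : ℕ) :
    f^[L * k] q = q := (Function.IsPeriodicPt.mul_const (show Function.IsPeriodicPt f L q from h) k)

lemma RR_disj {X : Type*} {f : X → X} {q q' : X} (h : q ≠ q') : Disjoint (RR f q) (RR f q') := by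
  rw [Set.disjoint_left]
  rintro y ⟨L, hL, h1, h2⟩ ⟨L', hL', h1', h2'⟩
  apply h
  have e1 : f^[L * L'] y = q := by
    obtain ⟨k, rfl⟩ : ∃ k, L' = k + 1 := ⟨L' - 1, by omega⟩
    rw [mul_add, mul_one, Function.iterate_add_apply, h2, per_mul h1]
  have e2 : f^[L' * L] y = q' := by
    obtain ⟨k, rfl⟩ : ∃ k, L = k + 1 := ⟨L - 1, by omega⟩
    rw [mul_add, mul_one, Function.iterate_add_apply, h2', per_mul h1']
  rw [← e1, ← e2, mul_comm]

lemma RR_inv {X : Type*} {f : X → X} {q y : X} {l : ℕ} (hl : f^[l] q = q) (hy : y ∈ RR f q) :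
    f^[l] y ∈ RR f q := by
  obtain ⟨L, hL, h1, h2⟩ := hy
  refine ⟨L, hL, h1, ?_⟩
  rw [← Function.iterate_add_apply, add_comm, Function.iterate_add_apply, h2, hl]

lemma good_U {X : Type*} [MetricSpace X] [CompactSpace X] (hX : IsRegCurve X)
    {f : X → X} (hf : IsMonotoneMap f)
    {M : Set X} (hM : IsMinimalSet f M) (hMinf : M.Infinite) (hMc : IsConnected M) :
    ∃ (U : Set X) (m m' : X), IsOpen U ∧ m ∈ M ∧ m ∈ U ∧ m' ∈ M ∧ m' ∉ closure U ∧
      (frontier U).Finite ∧ ∀ q ∈ frontier U, IsPeriodicPoint f q →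
        Disjoint (closure (⋃ n, f^[n] ⁻¹' {q})) M := by
  obtain ⟨m, hm, m', hm', hne⟩ := hMinf.nontrivial
  have hd : 0 < dist m m' := dist_pos.2 hne
  have hfin : {q | IsPeriodicPoint f q ∧ M ⊆ closure (RR f q)}.Finite := by
    have h1 := null_family hX (fun q : {q // IsPeriodicPoint f q} => RR f q)
      (fun q => RR_pre hf q) (fun i j hij => RR_disj (fun h => hij (Subtype.ext h)))
      (dist m m' / 2) (by linarith)
    refine (h1.image Subtype.val).subset ?_
    rintro q ⟨hq, hqM⟩
    refine ⟨⟨q, hq⟩, ?_, rfl⟩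
    obtain ⟨a, ha, ham⟩ := Metric.mem_closure_iff.1 (hqM hm) (dist m m' / 4) (by linarith)
    obtain ⟨b, hb, hbm⟩ := Metric.mem_closure_iff.1 (hqM hm') (dist m m' / 4) (by linarith)
    refine ⟨a, ha, b, hb, ?_⟩
    have := dist_triangle4 m a b m'
    rw [dist_comm b m'] at this
    linarith
  have hfin2 : {q | IsPeriodicPoint f q ∧ ¬ Disjoint (closure (⋃ n, f^[n] ⁻¹' {q})) M}.Finite := by
    refine hfin.subset ?_
    rintro q ⟨⟨l, hl, hq⟩, hnd⟩
    refine ⟨⟨l, hl, hq⟩, ?_⟩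
    obtain ⟨z, hz, hzM⟩ := Set.not_disjoint_iff.1 hnd
    have hsub : closure (⋃ n, f^[n] ⁻¹' {q}) ⊆
        ⋃ i ∈ Finset.range l, f^[i] ⁻¹' (closure (RR f q)) := by
      apply closure_minimal
      · intro y hy
        obtain ⟨n, hn⟩ := mem_iUnion.1 hy
        have hn' : f^[n] y = q := hn
        refine mem_iUnion₂.2 ⟨n % l, Finset.mem_range.2 (Nat.mod_lt _ hl), subset_closure ?_⟩
        refine ⟨l * (n / l + 1), Nat.mul_pos hl (Nat.succ_pos _), per_mul hq _, ?_⟩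
        rw [← Function.iterate_add_apply]
        have : l * (n / l + 1) + n % l = l + n := by
          have := Nat.div_add_mod n l
          rw [mul_add, mul_one]; omega
        rw [this, Function.iterate_add_apply, hn', hq]
      · exact (Finset.range l).finite_toSet.isClosed_biUnion
          fun i _ => isClosed_closure.preimage (hf.1.iterate i)
    obtain ⟨i, _, hi⟩ := mem_iUnion₂.1 (hsub hz)
    have := total_min hf.1 hM hMc hl (N := M ∩ closure (RR f q)) inter_subset_left
      ⟨f^[i] z, inv_iter hM.2.2.1 i hzM, hi⟩ (hM.2.1.inter isClosed_closure) (by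
        rintro x ⟨hx1, hx2⟩
        refine ⟨inv_iter hM.2.2.1 l hx1, ?_⟩
        exact map_mem_closure (hf.1.iterate l) hx2 (fun y hy => RR_inv hq hy))
    rw [← this]; exact inter_subset_right
  set E := {q | IsPeriodicPoint f q ∧ ¬ Disjoint (closure (⋃ n, f^[n] ⁻¹' {q})) M} with hE
  have hmE : m ∉ insert m' E := by
    rintro (h | h)
    · exact hne h
    · exact no_periodic hf.1 hM hMc hMinf hm h.1
  obtain ⟨δ, hδ, hball⟩ := Metric.mem_nhds_iff.1
    ((hfin2.insert m').isClosed.isOpen_compl.mem_nhds hmE)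
  obtain ⟨U, hUo, hmU, hUs, hUf⟩ := hX m (ball m (δ/2)) isOpen_ball (mem_ball_self (half_pos hδ))
  have hcl : closure U ⊆ (insert m' E)ᶜ :=
    (closure_mono hUs).trans ((closure_ball_subset_closedBall).trans
      ((closedBall_subset_ball (by linarith)).trans hball))
  refine ⟨U, m, m', hUo, hm, hmU, hm', fun h => hcl h (Or.inl rfl), hUf, ?_⟩
  intro q hq hper
  by_contra hcon
  exact hcl (frontier_subset_closure hq) (Or.inr ⟨hper, hcon⟩)

lemma fib_small {X : Type*} [MetricSpace X] [CompactSpace X] (hX : IsRegCurve X)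
    {f : X → X} (hf : IsMonotoneMap f) {q : X} (hq : ¬ IsPeriodicPoint f q) {ε : ℝ} (hε : 0 < ε) :
    ∀ᶠ n in atTop, ∀ a b, f^[n] a = q → f^[n] b = q → dist a b < ε := by
  have hdis : ∀ n n', n < n' → ∀ y, f^[n] y = q → f^[n'] y = q → False := by
    intro n n' hn y h1 h2
    refine hq ⟨n' - n, by omega, ?_⟩
    have : n' = (n' - n) + n := by omega
    rw [this, Function.iterate_add_apply, h1] at h2
    exact h2
  have h := null_family hX (fun n => f^[n] ⁻¹' {q}) (fun n => iter_pre hf n isPreconnected_singleton)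
    (fun n n' hne => Set.disjoint_left.2 fun y h1 h2 => by
      rcases lt_or_gt_of_ne hne with h | h
      · exact hdis _ _ h y h1 h2
      · exact hdis _ _ h y h2 h1) ε hε
  have h2 := h.eventually_cofinite_notMem
  rw [Nat.cofinite_eq_atTop] at h2
  filter_upwards [h2] with n hn a b ha hb
  by_contra hcon
  exact hn ⟨a, ha, b, hb, not_lt.1 hcon⟩

lemma tends_back {X : Type*} [MetricSpace X] [CompactSpace X] (hX : IsRegCurve X)
    {f : X → X} (hf : IsMonotoneMap f) {q : X} (hq : ¬ IsPeriodicPoint f q)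
    {u : ℕ → X} (hu : ∀ n, f^[n] (u n) = q) {F : Filter ℕ} (hF : F ≤ atTop) {c : X}
    (hc : Tendsto u F (𝓝 c)) (k : ℕ) {y : ℕ → X} (hy : ∀ᶠ n in F, f^[n - k] (y n) = q) :
    Tendsto y F (𝓝 (f^[k] c)) := by
  have h1 : Tendsto (fun n => f^[k] (u n)) F (𝓝 (f^[k] c)) :=
    ((hf.1.iterate k).tendsto c).comp hc
  refine h1.congr_dist ?_
  rw [Metric.tendsto_nhds]
  intro ε hε
  have h2 : ∀ᶠ n in atTop, ∀ a b, f^[n - k] a = q → f^[n - k] b = q → dist a b < ε :=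
    (tendsto_sub_atTop_nat k).eventually (fib_small hX hf hq hε)
  filter_upwards [hF h2, hF (eventually_ge_atTop k), hy] with n hn hk hyn
  have := hn (f^[k] (u n)) (y n) (by
    rw [← Function.iterate_add_apply, Nat.sub_add_cancel hk, hu]) hyn
  rw [Real.dist_eq, sub_zero, abs_of_nonneg dist_nonneg]
  exact this

lemma core_end {X : Type*} [MetricSpace X] [CompactSpace X] {f : X → X} (hf : Continuous f)
    {M : Set X} (hM : IsMinimalSet f M) (hMc : IsConnected M) {x : X}
    (hx : Tendsto (fun j => infDist (f^[j] x) M) atTop (𝓝 0))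
    {U : Set X} {m m' : X} (hU : IsOpen U) (hm : m ∈ M) (hmU : m ∈ U) (hm' : m' ∈ M)
    (hm'U : m' ∉ closure U) (V : Ultrafilter ℕ) (hV : (V : Filter ℕ) ≤ atTop) {l : ℕ} (hl : 1 ≤ l)
    (H : ∀ i, ∀ᶠ n in (V : Filter ℕ), (f^[n - i] x ∈ U ↔ f^[n - i + l] x ∈ U)) : False := by
  have hlim : ∀ i, ∃ a, Tendsto (fun n => f^[n - i] x) V (𝓝 a) := by
    intro i
    obtain ⟨a, -, ha⟩ := isCompact_univ.ultrafilter_le_nhds (V.map (fun n => f^[n - i] x)) (by simp)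
    exact ⟨a, ha⟩
  choose a ha using hlim
  have haM : ∀ i, a i ∈ M := by
    intro i
    rw [hM.2.1.mem_iff_infDist_zero hM.1]
    have h1 : Tendsto (fun n => infDist (f^[n - i] x) M) V (𝓝 (infDist (a i) M)) :=
      ((continuous_infDist_pt M).tendsto _).comp (ha i)
    have h2 : Tendsto (fun n => infDist (f^[n - i] x) M) V (𝓝 0) :=
      (hx.comp (tendsto_sub_atTop_nat i)).mono_left hV
    exact tendsto_nhds_unique h1 h2
  have hfa : ∀ i k, f^[k] (a (i + k)) = a i := by
    intro i k
    have h1 : Tendsto (fun n => f^[k] (f^[n - (i + k)] x)) V (𝓝 (f^[k] (a (i + k)))) :=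
      ((hf.iterate k).tendsto _).comp (ha (i + k))
    refine tendsto_nhds_unique h1 ((ha i).congr' ?_)
    filter_upwards [hV (eventually_ge_atTop (i + k))] with n hn
    rw [← Function.iterate_add_apply]
    congr 1
    have : n - i = k + (n - (i + k)) := by
      have : i + k ≤ n := hn
      omega
    rw [this]
  have hs : ∀ t, (∀ᶠ n in (V : Filter ℕ), f^[n - t * l] x ∈ U) ↔
      (∀ᶠ n in (V : Filter ℕ), f^[n - 0] x ∈ U) := by
    intro t
    induction t with
    | zero => simp
    | succ t ih =>
      rw [← ih]
      apply eventually_congr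
      filter_upwards [H ((t + 1) * l), hV (eventually_ge_atTop ((t + 1) * l))] with n hn hn2
      rw [hn]
      have : n - (t + 1) * l + l = n - t * l := by
        have h3 : (t + 1) * l ≤ n := hn2
        rw [add_mul, one_mul] at h3 ⊢
        omega
      rw [this]
  have hK : ∀ K : Set X, IsClosed K → (∀ t, a (t * l) ∈ K) → M ⊆ K := by
    intro K hK hKa
    let N : Set X := {z | MapClusterPt z atTop (fun t => a (t * l))}
    have hNsub : ∀ K' : Set X, IsClosed K' → (∀ t, a (t * l) ∈ K') → N ⊆ K' := by
      intro K' hK' h z hz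
      obtain ⟨W, hW, hWz⟩ := mapClusterPt_iff_ultrafilter.1 hz
      exact hK'.mem_of_tendsto hWz (Eventually.of_forall h)
    have := total_min hf hM hMc hl (N := N) (hNsub M hM.2.1 fun t => haM _) ?_
      isClosed_setOfPred_clusterPt ?_
    · rw [← this]; exact hNsub K hK hKa
    · obtain ⟨z, -, hz⟩ := isCompact_univ (X := X) (f := map (fun t => a (t * l)) atTop) (by simp)
      exact ⟨z, hz⟩
    · intro z hz
      obtain ⟨W, hW, hWz⟩ := mapClusterPt_iff_ultrafilter.1 hz
      have h1 : Tendsto (fun t => f^[l] (a (t * l))) W (𝓝 (f^[l] z)) :=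
        ((hf.iterate l).tendsto _).comp hWz
      refine mapClusterPt_iff_ultrafilter.2 ⟨W.map (fun t => t - 1), ?_, ?_⟩
      · exact (tendsto_sub_atTop_nat 1).mono_left hW
      · rw [Ultrafilter.coe_map, tendsto_map'_iff]
        refine h1.congr' ?_
        filter_upwards [hW (eventually_ge_atTop 1)] with t ht
        have ht' : 1 ≤ t := ht
        obtain ⟨s, rfl⟩ : ∃ s, t = s + 1 := ⟨t - 1, by omega⟩
        have := hfa (s * l) l
        rw [Function.comp_apply, Nat.add_sub_cancel, ← this, add_mul, one_mul]
  by_cases h0 : ∀ᶠ n in (V : Filter ℕ), f^[n - 0] x ∈ U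
  · refine hm'U (hK (closure U) isClosed_closure (fun t => ?_) hm')
    exact mem_closure_of_tendsto (ha _) ((hs t).2 h0)
  · refine hK Uᶜ hU.isClosed_compl (fun t => ?_) hm hmU
    have h1 : ¬ ∀ᶠ n in (V : Filter ℕ), f^[n - t * l] x ∈ U := fun h => h0 ((hs t).1 h)
    rw [← Ultrafilter.eventually_not] at h1
    exact hU.isClosed_compl.mem_of_tendsto (ha _) h1

lemma core {X : Type*} [MetricSpace X] [CompactSpace X] (hX : IsRegCurve X)
    {f : X → X} (hf : IsMonotoneMap f)
    {M : Set X} (hM : IsMinimalSet f M) (hMinf : M.Infinite) (hMc : IsConnected M) {x : X}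
    (hx : Tendsto (fun j => infDist (f^[j] x) M) atTop (𝓝 0)) :
    ∃ G : Set X, IsOpen G ∧ M ⊆ G ∧ ∀ j j', j < j' → ∀ C : Set X, IsCompact C →
      IsPreconnected C → C ⊆ G \ M → f^[j] x ∈ C → f^[j'] x ∈ C → False := by
  obtain ⟨U, m, m', hU, hm, hmU, hm', hm'U, hF, hper⟩ := good_U hX hf hM hMinf hMc
  let ι := {q // q ∈ frontier U ∧ ¬ IsPeriodicPoint f q ∧ ∀ n, ∃ y, f^[n] y = q}
  have hιfin : Finite ι := (hF.subset (fun q (hq : q ∈ {q | q ∈ frontier U ∧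
    ¬ IsPeriodicPoint f q ∧ ∀ n, ∃ y, f^[n] y = q}) => hq.1)).to_subtype
  choose u hu using fun q : ι => q.2.2.2
  let g : (ι → X) → (ι → X) := fun c q => f (c q)
  have hg : Continuous g := by
    refine continuous_pi fun q => hf.1.comp (continuous_apply q)
  have hgk : ∀ k c q, (g^[k] c) q = f^[k] (c q) := by
    intro k
    induction k with
    | zero => intro c q; rfl
    | succ k ih => intro c q; rw [Function.iterate_succ_apply, Function.iterate_succ_apply, ih]
  let CC : Set (ι → X) := {c | MapClusterPt c atTop (fun n q => u q n)}
  have hCCne : CC.Nonempty := by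
    obtain ⟨z, -, hz⟩ := isCompact_univ (X := ι → X) (f := map (fun n q => u q n) atTop) (by simp)
    exact ⟨z, hz⟩
  have hCCc : IsClosed CC := isClosed_setOfPred_clusterPt
  have hCCi : g '' CC ⊆ CC := by
    rintro _ ⟨c, hc, rfl⟩
    obtain ⟨W, hW, hWc⟩ := mapClusterPt_iff_ultrafilter.1 hc
    refine mapClusterPt_iff_ultrafilter.2 ⟨W.map (fun t => t - 1), ?_, ?_⟩
    · exact (tendsto_sub_atTop_nat 1).mono_left hW
    · rw [Ultrafilter.coe_map, tendsto_map'_iff]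
      rw [tendsto_pi_nhds] at hWc ⊢
      intro q
      exact tends_back hX hf q.2.2.1 (hu q) hW (hWc q) 1 (Eventually.of_forall fun n => hu q (n - 1))
  obtain ⟨N, hNC, hN⟩ := exists_minimal g CC hCCne hCCc hCCi
  have hdich : ∀ q : ι, (∀ d ∈ N, d q ∈ M) ∨ (∀ d ∈ N, d q ∉ M) := by
    intro q
    rw [or_iff_not_imp_right]
    intro h
    push Not at h
    obtain ⟨d, hd, hdM⟩ := h
    have := hN.2.2.2 (N ∩ (fun d => d q) ⁻¹' M) inter_subset_left ⟨d, hd, hdM⟩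
      (hN.2.1.inter (hM.2.1.preimage (continuous_apply q))) (by
        rintro _ ⟨e, ⟨he, heM⟩, rfl⟩
        exact ⟨hN.2.2.1 ⟨e, he, rfl⟩, hM.2.2.1 ⟨e q, heM, rfl⟩⟩)
    intro e he
    rw [← this] at he
    exact he.2
  let A : ι → Set X := fun q => (fun d : ι → X => d q) '' N
  have hAc : ∀ q, IsClosed (A q) := fun q => (hN.2.1.isCompact.image (continuous_apply q)).isClosed
  let B1 : Set X := ⋃ q ∈ {q : ι | ∀ d ∈ N, d q ∉ M}, A q
  let B2 : Set X := ⋃ q ∈ {q | q ∈ frontier U ∧ IsPeriodicPoint f q}, closure (⋃ n, f^[n] ⁻¹' {q})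
  have hB1 : IsClosed B1 := (Set.toFinite _).isClosed_biUnion fun q _ => hAc q
  have hB2 : IsClosed B2 := (hF.subset (fun q hq => hq.1)).isClosed_biUnion
    fun q _ => isClosed_closure
  refine ⟨(B1 ∪ B2)ᶜ, (hB1.union hB2).isOpen_compl, ?_, ?_⟩
  · rintro z hz (h | h)
    · obtain ⟨q, hq, d, hd, rfl⟩ := mem_iUnion₂.1 h
      exact hq d hd hz
    · obtain ⟨q, hq, hzq⟩ := mem_iUnion₂.1 h
      exact Set.disjoint_left.1 (hper q hq.1 hq.2) hzq hz
  · intro j j' hjj C hCk hCp hCG hxC hxC'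
    obtain ⟨c, hc⟩ := hN.1
    obtain ⟨V, hV, hVc⟩ := mapClusterPt_iff_ultrafilter.1 (hNC hc)
    rw [tendsto_pi_nhds] at hVc
    have claim : ∀ k, ∀ᶠ n in (V : Filter ℕ),
        (f^[n - k] (f^[j] x) ∈ U ↔ f^[n - k] (f^[j'] x) ∈ U) := by
      intro k
      by_contra hcon
      rw [← Ultrafilter.eventually_not] at hcon
      have h1 : ∀ᶠ n in (V : Filter ℕ), ∃ q ∈ frontier U, ∃ y ∈ C, f^[n - k] y = q := by
        filter_upwards [hcon] with n hn
        have hpre : IsPreconnected (f^[n - k] '' C) := hCp.image _ (hf.1.iterate _).continuousOn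
        have : ∃ p ∈ f^[n - k] '' C, p ∈ frontier U := by
          by_cases h : f^[n - k] (f^[j] x) ∈ U
          · have h' : f^[n - k] (f^[j'] x) ∉ U := fun h' => hn (by simp [h, h'])
            exact meets_frontier hpre hU ⟨_, hxC, rfl⟩ ⟨_, hxC', rfl⟩ h h'
          · have h' : f^[n - k] (f^[j'] x) ∈ U := by
              by_contra h'
              exact hn (by simp [h, h'])
            exact meets_frontier hpre hU ⟨_, hxC', rfl⟩ ⟨_, hxC, rfl⟩ h' h
        obtain ⟨_, ⟨y, hy, rfl⟩, hp⟩ := this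
        exact ⟨_, hp, y, hy, rfl⟩
      rw [Ultrafilter.eventually_exists_mem_iff hF] at h1
      obtain ⟨q, hq, h2⟩ := h1
      by_cases hqp : IsPeriodicPoint f q
      · obtain ⟨n, y, hy, hyq⟩ := h2.exists
        refine (hCG hy).1 (Or.inr (mem_iUnion₂.2 ⟨q, ⟨hq, hqp⟩, subset_closure ?_⟩))
        exact mem_iUnion.2 ⟨n - k, hyq⟩
      · by_cases hqs : ∀ n, ∃ y, f^[n] y = q
        · let q' : ι := ⟨q, hq, hqp, hqs⟩
          have h3 : ∀ n, ∃ y, (∃ y ∈ C, f^[n - k] y = q) → y ∈ C ∧ f^[n - k] y = q := by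
            intro n
            by_cases h : ∃ y ∈ C, f^[n - k] y = q
            · obtain ⟨y, hy⟩ := h
              exact ⟨y, fun _ => hy⟩
            · exact ⟨x, fun h' => absurd h' h⟩
          choose y hy using h3
          have h4 := tends_back hX hf hqp (hu q') hV (hVc q') k (y := y)
            (h2.mono fun n hn => (hy n hn).2)
          have h5 : f^[k] (c q') ∈ C := hCk.isClosed.mem_of_tendsto h4 (h2.mono fun n hn => (hy n hn).1)
          have h6 : g^[k] c ∈ N := inv_iter hN.2.2.1 k hc
          rcases hdich q' with h | h
          · have := h _ h6
            rw [hgk] at this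
            exact (hCG h5).2 this
          · refine (hCG h5).1 (Or.inl (mem_iUnion₂.2 ⟨q', h, g^[k] c, h6, ?_⟩))
            exact hgk k c q'
        · push Not at hqs
          obtain ⟨n0, hn0⟩ := hqs
          obtain ⟨n, ⟨y, -, hy⟩, hn⟩ := (h2.and (hV (eventually_ge_atTop (n0 + k)))).exists
          have hn' : n0 + k ≤ n := hn
          refine hn0 (f^[n - k - n0] y) ?_
          rw [← Function.iterate_add_apply, ← hy]
          congr 2
          omega
    refine core_end hf.1 hM hMc hx hU hm hmU hm' hm'U V hV (l := j' - j) (by omega) ?_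
    intro i
    filter_upwards [claim (j + i), hV (eventually_ge_atTop (j + i))] with n hn hn2
    have hn2' : j + i ≤ n := hn2
    rw [← Function.iterate_add_apply, ← Function.iterate_add_apply] at hn
    have e1 : n - (j + i) + j = n - i := by omega
    have e2 : n - (j + i) + j' = n - i + (j' - j) := by omega
    rw [e1, e2] at hn
    exact hn

lemma comp_closed {X : Type*} [TopologicalSpace X] {F : Set X} {x p : X} (hx : x ∈ F)
    (hp : p ∈ closure (connectedComponentIn F x)) (hpF : p ∈ F) : p ∈ connectedComponentIn F x := by
  have h1 : IsPreconnected (insert p (connectedComponentIn F x)) :=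
    isPreconnected_connectedComponentIn.subset_closure (subset_insert _ _)
      (insert_subset hp subset_closure)
  exact h1.subset_connectedComponentIn (Or.inr (mem_connectedComponentIn hx))
    (insert_subset hpF (connectedComponentIn_subset F x)) (Or.inl rfl)

lemma dec_inter {X : Type*} [MetricSpace X] [CompactSpace X] (K : ℕ → Set X) (hK : Antitone K)
    (hc : ∀ n, IsClosed (K n)) (hp : ∀ n, IsPreconnected (K n)) : IsPreconnected (⋂ n, K n) := by
  rw [isPreconnected_iff_subset_of_disjoint_closed]
  intro u v hu hv huv hdis
  have hL : IsClosed (⋂ n, K n) := isClosed_iInter hc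
  have hd : Disjoint ((⋂ n, K n) ∩ u) ((⋂ n, K n) ∩ v) := by
    rw [Set.disjoint_left]
    rintro z ⟨h1, h2⟩ ⟨_, h3⟩
    have : z ∈ (⋂ n, K n) ∩ (u ∩ v) := ⟨h1, h2, h3⟩
    rw [hdis] at this
    exact this
  obtain ⟨U, V, hU, hV, huU, hvV, hUV⟩ := normal_separation (hL.inter hu) (hL.inter hv) hd
  obtain ⟨n, hn⟩ := exists_subset_nhds_of_isCompact (V := K) (U := U ∪ V) hK.directed_ge
    (fun n => (hc n).isCompact) (fun z hz => (hU.union hV).mem_nhds (by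
      rcases huv hz with h | h
      · exact Or.inl (huU ⟨hz, h⟩)
      · exact Or.inr (hvV ⟨hz, h⟩)))
  have := isPreconnected_iff_subset_of_disjoint.1 (hp n) U V hU hV hn (by
    rw [hUV.inter_eq, inter_empty])
  rcases this with h | h
  · left
    intro z hz
    rcases huv hz with h' | h'
    · exact h'
    · exact absurd (hvV ⟨hz, h'⟩) (Set.disjoint_left.1 hUV (h (mem_iInter.1 hz n)))
  · right
    intro z hz
    rcases huv hz with h' | h'
    · exact absurd (h (mem_iInter.1 hz n)) (Set.disjoint_left.1 hUV (huU ⟨hz, h'⟩))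
    · exact h'

lemma exists_lim {X : Type*} [TopologicalSpace X] [CompactSpace X] (V : Ultrafilter ℕ) (u : ℕ → X) :
    ∃ a, Tendsto u V (𝓝 a) := by
  obtain ⟨a, -, ha⟩ := isCompact_univ.ultrafilter_le_nhds (V.map u) (by simp)
  exact ⟨a, ha⟩

lemma lim_mem_omega {X : Type*} [TopologicalSpace X] {f : X → X} {y z : X} (V : Ultrafilter ℕ)
    (hV : (V : Filter ℕ) ≤ atTop) (h : Tendsto (fun n => f^[n] y) V (𝓝 z)) :
    z ∈ omegaLimitSet f y := by
  refine mem_iInter.2 fun n => ?_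
  refine mem_closure_of_tendsto h ?_
  filter_upwards [hV (eventually_ge_atTop n)] with k hk
  exact ⟨k, hk, rfl⟩

lemma omega_of_tendsto {X : Type*} [MetricSpace X] [CompactSpace X] {f : X → X} (hf : Continuous f)
    {M : Set X} (hM : IsMinimalSet f M) {y : X}
    (hy : Tendsto (fun j => infDist (f^[j] y) M) atTop (𝓝 0)) : omegaLimitSet f y = M := by
  apply hM.2.2.2
  · intro z hz
    rw [hM.2.1.mem_iff_infDist_zero hM.1]
    refine le_antisymm (le_of_forall_pos_le_add fun ε hε => ?_) infDist_nonneg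
    obtain ⟨n, hn⟩ := eventually_atTop.1 (hy.eventually (gt_mem_nhds hε))
    have hcl : IsClosed {w | infDist w M ≤ ε} :=
      isClosed_le (continuous_infDist_pt M) continuous_const
    have : closure ((fun k => f^[k] y) '' Set.Ici n) ⊆ {w | infDist w M ≤ ε} := by
      refine closure_minimal ?_ hcl
      rintro _ ⟨k, hk, rfl⟩
      exact (hn k hk).le
    rw [zero_add]
    exact this (mem_iInter.1 hz n)
  · obtain ⟨V, hV⟩ := Ultrafilter.exists_le (atTop : Filter ℕ)
    obtain ⟨a, ha⟩ := exists_lim V (fun n => f^[n] y)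
    exact ⟨a, lim_mem_omega V hV ha⟩
  · exact isClosed_iInter fun n => isClosed_closure
  · rintro _ ⟨z, hz, rfl⟩
    refine mem_iInter.2 fun n => ?_
    refine map_mem_closure hf (mem_iInter.1 hz n) ?_
    rintro _ ⟨k, hk, rfl⟩
    refine ⟨k + 1, ?_, ?_⟩
    · exact le_trans (show n ≤ k from hk) (Nat.le_succ k)
    · exact Function.iterate_succ_apply' f k y

lemma tendsto_of_omega {X : Type*} [MetricSpace X] [CompactSpace X] {f : X → X}
    {M : Set X} {y : X} (h : omegaLimitSet f y = M) :
    Tendsto (fun j => infDist (f^[j] y) M) atTop (𝓝 0) := by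
  rw [tendsto_iff_ultrafilter]
  intro V hV
  obtain ⟨a, ha⟩ := exists_lim V (fun n => f^[n] y)
  have haM : a ∈ M := h ▸ lim_mem_omega V hV ha
  have h1 : Tendsto (fun n => infDist (f^[n] y) M) V (𝓝 (infDist a M)) :=
    ((continuous_infDist_pt M).tendsto _).comp ha
  rwa [infDist_zero_of_mem haM] at h1

lemma comp_small {X : Type*} [MetricSpace X] [CompactSpace X] [ConnectedSpace X]
    (hX : IsRegCurve X) {f : X → X} (hf : IsMonotoneMap f)
    {M : Set X} (hM : IsMinimalSet f M) (hMinf : M.Infinite) (hMc : IsConnected M) {x : X}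
    (hx : Tendsto (fun j => infDist (f^[j] x) M) atTop (𝓝 0)) (hxM : ∀ n, f^[n] x ∉ M)
    {ε : ℝ} (hε : 0 < ε) :
    ∀ᶠ j in atTop, ∀ b ∈ connectedComponentIn Mᶜ (f^[j] x), dist b (f^[j] x) < ε := by
  have := loc_conn hX
  obtain ⟨G, hG, hMG, hcore⟩ := core hX hf hM hMinf hMc hx
  have hGM : IsOpen (G \ M) := hG.sdiff hM.2.1
  let O : ℕ → Set X := fun j => connectedComponentIn (G \ M) (f^[j] x)
  have hdis' : ∀ j j', j < j' → Disjoint (O j) (O j') := by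
    intro j j' hjj
    rw [Set.disjoint_left]
    intro z hz hz'
    have e : O j = O j' := (connectedComponentIn_eq hz).trans (connectedComponentIn_eq hz').symm
    have hj : f^[j] x ∈ O j := mem_connectedComponentIn (connectedComponentIn_nonempty_iff.1 ⟨z, hz⟩)
    have hj' : f^[j'] x ∈ O j := by
      rw [e]; exact mem_connectedComponentIn (connectedComponentIn_nonempty_iff.1 ⟨z, hz'⟩)
    obtain ⟨C, h1, h2, h3, h4, h5⟩ := chain_lemma hGM.connectedComponentIn
      isPreconnected_connectedComponentIn hj hj'
    exact hcore j j' hjj C h1 h2 (h3.trans (connectedComponentIn_subset _ _)) h4 h5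
  have hsm : ∀ ε : ℝ, 0 < ε → ∀ᶠ j in atTop, ∀ a ∈ O j, ∀ b ∈ O j, dist a b < ε := by
    intro ε hε
    have h2 := (null_family hX O (fun j => isPreconnected_connectedComponentIn) (fun i j hij => by
      rcases lt_or_gt_of_ne hij with h | h
      · exact hdis' _ _ h
      · exact (hdis' _ _ h).symm) ε hε).eventually_cofinite_notMem
    rw [Nat.cofinite_eq_atTop] at h2
    filter_upwards [h2] with n hn a ha b hb
    by_contra hcon
    exact hn ⟨a, ha, b, hb, not_lt.1 hcon⟩
  obtain ⟨δ, hδ, hδG⟩ := hM.2.1.isCompact.exists_thickening_subset_open hG hMG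
  have hin : ∀ w, infDist w M < δ → w ∈ G := fun w hw =>
    hδG ((mem_thickening_iff_infDist_lt hM.1).2 hw)
  filter_upwards [hsm ε hε, hsm (δ/2) (half_pos hδ), hx.eventually (gt_mem_nhds (half_pos hδ))]
    with j h1 h2 h3 b hb
  have hxG : f^[j] x ∈ G \ M := ⟨hin _ (by linarith), hxM j⟩
  have hxO : f^[j] x ∈ O j := mem_connectedComponentIn hxG
  have hOG : closure (O j) ⊆ G := by
    intro w hw
    apply hin
    have h4 : closure (O j) ⊆ closedBall (f^[j] x) (δ/2) :=
      closure_minimal (fun z hz => (h2 z hz _ hxO).le) isClosed_closedBall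
    have h5 : dist w (f^[j] x) ≤ δ/2 := h4 hw
    have h6 := infDist_le_infDist_add_dist (s := M) (x := w) (y := f^[j] x)
    linarith
  have hbO : b ∈ O j := by
    by_contra hbO
    obtain ⟨p, hp1, hp2⟩ := meets_frontier isPreconnected_connectedComponentIn
      (hGM.connectedComponentIn (x := f^[j] x)) (mem_connectedComponentIn (hxM j)) hb hxO hbO
    rw [hGM.connectedComponentIn.frontier_eq] at hp2
    exact hp2.2 (comp_closed hxG hp2.1 ⟨hOG hp2.1, connectedComponentIn_subset _ _ hp1⟩)
  exact h1 b hbO _ hxO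

theorem stmt_6 {X : Type*} [MetricSpace X] [CompactSpace X] [ConnectedSpace X]
    (hX : IsRegCurve X) (f : X → X) (hf : IsMonotoneMap f)
    (M : Set X) (hM : IsMinimalSet f M) (hMinf : M.Infinite)
    (hMconn : IsConnected M) :
    IsConnected {x : X | omegaLimitSet f x = M} := by
  have hlc := loc_conn hX
  have hpreA : ∀ n, ∀ y, f^[n] y ∈ M → omegaLimitSet f y = M := by
    intro n y hy
    apply omega_of_tendsto hf.1 hM
    refine tendsto_const_nhds.congr' ?_
    filter_upwards [eventually_ge_atTop n] with k hk
    have : k = (k - n) + n := by omega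
    rw [this, Function.iterate_add_apply, infDist_zero_of_mem (inv_iter hM.2.2.1 _ hy)]
  obtain ⟨m0, hm0⟩ := hM.1
  refine ⟨⟨m0, hpreA 0 m0 hm0⟩, ?_⟩
  apply isPreconnected_of_forall m0
  intro x hxA
  by_cases hxM : ∃ n, f^[n] x ∈ M
  · obtain ⟨n, hn⟩ := hxM
    exact ⟨f^[n] ⁻¹' M, fun y hy => hpreA n y hy, inv_iter hM.2.2.1 n hm0, hn,
      iter_pre hf n hMconn.isPreconnected⟩
  push Not at hxM
  have hx := tendsto_of_omega hxA
  let W : ℕ → Set X := fun n => connectedComponentIn Mᶜ (f^[n] x)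
  have hWM : ∀ n, W n ⊆ Mᶜ := fun n => connectedComponentIn_subset _ _
  have hWo : ∀ n, IsOpen (W n) := fun n => hM.2.1.isOpen_compl.connectedComponentIn
  have hxW : ∀ n, f^[n] x ∈ W n := fun n => mem_connectedComponentIn (hxM n)
  let V : ℕ → Set X := fun n => f^[n] ⁻¹' (W n)
  have hVanti : Antitone V := by
    apply antitone_nat_of_succ_le
    intro n y hy
    have h1 : IsPreconnected (f ⁻¹' (W (n + 1))) := hf.2 _ isPreconnected_connectedComponentIn
    have h2 : f ⁻¹' (W (n + 1)) ⊆ W n := by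
      apply h1.subset_connectedComponentIn
      · rw [mem_preimage, ← Function.iterate_succ_apply' f n x]
        exact hxW (n + 1)
      · intro z hz hzM
        exact hWM _ hz (hM.2.2.1 ⟨z, hzM, rfl⟩)
    apply h2
    rw [mem_preimage, ← Function.iterate_succ_apply' f n y]
    exact hy
  let L : Set X := ⋂ n, closure (V n)
  have hVp : ∀ n, IsPreconnected (V n) := fun n => iter_pre hf n isPreconnected_connectedComponentIn
  have hLp : IsPreconnected L := dec_inter _ (fun i j hij => closure_mono (hVanti hij))
    (fun n => isClosed_closure) (fun n => (hVp n).closure)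
  have hxL : x ∈ L := mem_iInter.2 fun n => subset_closure (hxW n)
  have hmap : ∀ n, ∀ y ∈ closure (V n), f^[n] y ∈ closure (W n) := fun n y hy =>
    map_mem_closure (hf.1.iterate n) hy (fun z hz => hz)
  have hLA : ∀ y ∈ L, omegaLimitSet f y = M := by
    intro y hy
    apply omega_of_tendsto hf.1 hM
    rw [Metric.tendsto_nhds]
    intro ε hε
    filter_upwards [comp_small hX hf hM hMinf hMconn hx hxM (half_pos hε),
      hx.eventually (gt_mem_nhds (half_pos hε))] with n h1 h2
    have h4 : closure (W n) ⊆ closedBall (f^[n] x) (ε/2) :=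
      closure_minimal (fun z hz => (h1 z hz).le) isClosed_closedBall
    have h5 : dist (f^[n] y) (f^[n] x) ≤ ε/2 := h4 (hmap n y (mem_iInter.1 hy n))
    have h6 := infDist_le_infDist_add_dist (s := M) (x := f^[n] y) (y := f^[n] x)
    rw [Real.dist_eq, sub_zero, abs_of_nonneg infDist_nonneg]
    linarith
  let Y : Set X := ⋃ n, f^[n] ⁻¹' M
  have hYp : IsPreconnected Y := isPreconnected_iUnion
    ⟨m0, mem_iInter.2 fun n => inv_iter hM.2.2.1 n hm0⟩
    (fun n => iter_pre hf n hMconn.isPreconnected)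
  have hm0Y : m0 ∈ Y := mem_iUnion.2 ⟨0, hm0⟩
  have hYA : ∀ y ∈ Y, omegaLimitSet f y = M := by
    intro y hy
    obtain ⟨n, hn⟩ := mem_iUnion.1 hy
    exact hpreA n y hn
  have hne : ∀ n, (closure (V n) ∩ closure Y).Nonempty := by
    intro n
    have hVo : IsOpen (V n) := (hWo n).preimage (hf.1.iterate n)
    obtain ⟨p, -, hp⟩ := meets_frontier isPreconnected_univ hVo (mem_univ x) (mem_univ m0)
      (hxW n) (fun h => hWM n h (inv_iter hM.2.2.1 n hm0))
    rw [hVo.frontier_eq] at hp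
    refine ⟨p, hp.1, subset_closure (mem_iUnion.2 ⟨n, ?_⟩)⟩
    by_contra hpM
    exact hp.2 (comp_closed (hxM n) (hmap n p hp.1) hpM)
  obtain ⟨l, hl⟩ := IsCompact.nonempty_iInter_of_sequence_nonempty_isCompact_isClosed
    (fun n => closure (V n) ∩ closure Y)
    (fun n => inter_subset_inter_left _ (closure_mono (hVanti (Nat.le_succ n)))) hne
    (isClosed_closure.inter isClosed_closure).isCompact
    (fun n => isClosed_closure.inter isClosed_closure)
  have hlL : l ∈ L := mem_iInter.2 fun n => (mem_iInter.1 hl n).1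
  have hlY : l ∈ closure Y := (mem_iInter.1 hl 0).2
  have hYl : IsPreconnected (insert l Y) :=
    hYp.subset_closure (subset_insert _ _) (insert_subset hlY subset_closure)
  refine ⟨insert l Y ∪ L, ?_, Or.inl (Or.inr hm0Y), Or.inr hxL,
    hYl.union l (Or.inl rfl) hlL hLp⟩
  rintro y ((rfl | hy) | hy)
  · exact hLA _ hlL
  · exact hYA y hy
  · exact hLA y hy
end

section
/- Let X be a regular curve and f : X → X a monotone continuous map with no periodic points (P(f) = ∅). Then the collection of minimal sets of f either consists of exactly one minimal set or is uncountable. -/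
open Set Filter Metric Topology Function

lemma aux_preconn_meets {X : Type*} [TopologicalSpace X] {S U : Set X} (hS : IsPreconnected S)
    (hU : IsOpen U) (h1 : (S ∩ U).Nonempty) (h2 : ¬ S ⊆ U) : (S ∩ frontier U).Nonempty := by
  by_contra hne
  apply h2
  have hd : ∀ y ∈ S, y ∉ frontier U := fun y hy hyf => hne ⟨y, hy, hyf⟩
  refine hS.subset_left_of_subset_union hU (isClosed_closure (s := U)).isOpen_compl ?_ ?_ h1
  · exact Set.disjoint_left.2 fun y hy hy' => hy' (subset_closure hy)
  · intro y hy
    by_cases hyU : y ∈ U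
    · exact Or.inl hyU
    · right
      intro hyc
      exact hd y hy (by rw [hU.frontier_eq]; exact ⟨hyc, hyU⟩)

lemma aux_finite_set {X : Type*} [MetricSpace X] [CompactSpace X] (hX : IsRegCurve X)
    {ε : ℝ} (hε : 0 < ε) : ∃ F : Finset X, ∀ S : Set X, IsPreconnected S →
      (∀ p ∈ F, p ∉ S) → ∀ y ∈ S, ∀ z ∈ S, dist y z < ε := by
  classical
  have h : ∀ x : X, ∃ U : Set X, IsOpen U ∧ x ∈ U ∧ U ⊆ ball x (ε / 2) ∧ (frontier U).Finite :=
    fun x => hX x (ball x (ε / 2)) isOpen_ball (mem_ball_self (by positivity))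
  choose U hUo hxU hUb hUf using h
  obtain ⟨t, ht⟩ := isCompact_univ.elim_finite_subcover U hUo
    (fun x _ => Set.mem_iUnion.2 ⟨x, hxU x⟩)
  refine ⟨t.biUnion fun x => (hUf x).toFinset, ?_⟩
  intro S hS hp y hy z hz
  obtain ⟨x, hxt, hyx⟩ : ∃ x ∈ t, y ∈ U x := by
    simpa using ht (Set.mem_univ y)
  have hsub : S ⊆ U x := by
    by_contra hns
    obtain ⟨p, hpS, hpf⟩ := aux_preconn_meets hS (hUo x) ⟨y, hy, hyx⟩ hns
    exact hp p (Finset.mem_biUnion.2 ⟨x, hxt, (hUf x).mem_toFinset.2 hpf⟩) hpS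
  have h1 := mem_ball.1 (hUb x hyx)
  have h2 := mem_ball.1 (hUb x (hsub hz))
  have := dist_triangle_right y z x
  linarith

lemma aux_preimage {X : Type*} [TopologicalSpace X] {f : X → X} (hf : IsMonotoneMap f)
    (p : X) (n : ℕ) : IsPreconnected (f^[n] ⁻¹' {p}) := by
  induction n with
  | zero => simpa using isPreconnected_singleton
  | succ n ih =>
    rw [Function.iterate_succ, Set.preimage_comp]
    exact hf.2 _ ih

lemma aux_small_preimage {X : Type*} [MetricSpace X] [CompactSpace X] (hX : IsRegCurve X)
    {f : X → X} (hf : IsMonotoneMap f) (hP : ∀ x : X, ¬ IsPeriodicPoint f x)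
    (p : X) {η : ℝ} (hη : 0 < η) :
    ∀ᶠ n in atTop, ∀ y z, f^[n] y = p → f^[n] z = p → dist y z < η := by
  obtain ⟨F, hF⟩ := aux_finite_set hX hη
  have h1 : ∀ q ∈ F, ∀ᶠ n in atTop, f^[n] q ≠ p := by
    intro q _
    by_cases h : ∃ m, f^[m] q = p
    · obtain ⟨m, hm⟩ := h
      filter_upwards [eventually_gt_atTop m] with n hn hnp
      apply hP p
      refine ⟨n - m, by omega, ?_⟩
      have : f^[n - m] (f^[m] q) = f^[n] q := by
        rw [← Function.iterate_add_apply]; congr 2; omega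
      rw [hm, hnp] at this
      exact this
    · exact Filter.Eventually.of_forall fun n hn => h ⟨n, hn⟩
  have h2 : ∀ᶠ n in atTop, ∀ q ∈ F, f^[n] q ≠ p := (Filter.eventually_all_finset F).2 h1
  filter_upwards [h2] with n hn y z hy hz
  exact hF _ (aux_preimage hf p n) (fun q hq hq' => hn q hq hq') y hy z hz

lemma aux_locconn {X : Type*} [MetricSpace X] [CompactSpace X] [ConnectedSpace X]
    (hX : IsRegCurve X) (x : X) (V : Set X) (hV : V ∈ 𝓝 x) :
    ∃ C ∈ 𝓝 x, C ⊆ V ∧ IsPreconnected C := by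
  obtain ⟨W, hW, hWc, hWV⟩ := exists_mem_nhds_isClosed_subset hV
  obtain ⟨U, hUo, hxU, hUW, hUf⟩ := hX x (interior W) isOpen_interior (mem_interior_iff_mem_nhds.2 hW)
  have hcl : closure U ⊆ V :=
    (closure_minimal (hUW.trans interior_subset) hWc).trans hWV
  by_cases hfr : frontier U = ∅
  · have : IsClopen U := isClopen_iff_frontier_eq_empty.2 hfr
    rw [isClopen_iff] at this
    rcases this with h | h
    · rw [h] at hxU; exact hxU.elim
    · refine ⟨Set.univ, univ_mem, ?_, isPreconnected_univ⟩
      rw [← h]; exact subset_closure.trans hcl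
  let K := closure U
  have hKc : IsClosed K := isClosed_closure
  have : CompactSpace K := isCompact_iff_compactSpace.1 hKc.isCompact
  -- every component of K meets the frontier
  have hbump : ∀ y : K, ∃ p : K, (p : X) ∈ frontier U ∧ p ∈ connectedComponent y := by
    intro y
    by_contra hno
    push Not at hno
    have hcc := connectedComponent_eq_iInter_isClopen y
    let G : Set K := {p : K | (p : X) ∈ frontier U}
    have hGc : IsClosed G := isClosed_frontier.preimage continuous_subtype_val
    have hGi : G ∩ ⋂ s : {s : Set K // IsClopen s ∧ y ∈ s}, (s : Set K) = ∅ := by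
      rw [← hcc]
      ext p
      simp only [Set.mem_inter_iff, Set.mem_empty_iff_false, iff_false, not_and]
      exact fun hp => hno p hp
    obtain ⟨t, ht⟩ := hGc.isCompact.elim_finite_subfamily_closed
      (fun s : {s : Set K // IsClopen s ∧ y ∈ s} => (s : Set K)) (fun s => s.2.1.1) hGi
    let D : Set K := ⋂ s ∈ t, (s : Set K)
    have hD : IsClopen D := isClopen_biInter_finset (fun s _ => s.2.1)
    have hyD : y ∈ D := Set.mem_iInter₂.2 fun s _ => s.2.2
    have hDU : ∀ p ∈ D, (p : X) ∈ U := by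
      intro p hp
      by_contra hpU
      have : p ∈ G ∩ ⋂ s ∈ t, (s : Set K) := ⟨by
        change (p : X) ∈ frontier U
        rw [hUo.frontier_eq]; exact ⟨p.2, hpU⟩, hp⟩
      rw [ht] at this
      exact this
    have hclD : IsClosed ((↑) '' D : Set X) := hKc.isClosedMap_subtype_val _ hD.1
    have hopD : IsOpen ((↑) '' D : Set X) := by
      obtain ⟨O, hO, hOD⟩ := isOpen_induced_iff.1 hD.2
      have : ((↑) '' D : Set X) = O ∩ U := by
        ext z
        constructor
        · rintro ⟨p, hp, rfl⟩
          refine ⟨?_, hDU p hp⟩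
          rw [← hOD] at hp
          exact hp
        · rintro ⟨hzO, hzU⟩
          refine ⟨⟨z, subset_closure hzU⟩, ?_, rfl⟩
          rw [← hOD]
          exact hzO
      rw [this]
      exact hO.inter hUo
    rcases isClopen_iff.1 ⟨hclD, hopD⟩ with h | h
    · have : (y : X) ∈ ((↑) '' D : Set X) := ⟨y, hyD, rfl⟩
      rw [h] at this; exact this
    · apply hfr
      have hUu : U = Set.univ := by
        apply Set.eq_univ_of_univ_subset
        rw [← h]
        rintro _ ⟨p, hp, rfl⟩
        exact hDU p hp
      rw [hUu, frontier_univ]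
  let G : Set K := {p : K | (p : X) ∈ frontier U}
  have hGfin : G.Finite := hUf.preimage Subtype.val_injective.injOn
  let x' : K := ⟨x, subset_closure hxU⟩
  have hcomp : connectedComponent x' ∈ 𝓝 x' := by
    have hfin : IsClosed (⋃ p ∈ {p ∈ G | p ∉ connectedComponent x'}, connectedComponent p) :=
      (hGfin.subset (Set.sep_subset _ _)).isClosed_biUnion fun p _ => isClosed_connectedComponent
    have heq : (⋃ p ∈ {p ∈ G | p ∉ connectedComponent x'}, connectedComponent p)ᶜ
        = connectedComponent x' := by
      ext z
      simp only [Set.mem_compl_iff, Set.mem_iUnion, not_exists]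
      constructor
      · intro h
        obtain ⟨p, hpf, hpz⟩ := hbump z
        by_contra hz
        refine h p ⟨hpf, ?_⟩ ?_
        · intro hp
          rw [connectedComponent_eq_iff_mem.2 hp |>.symm] at hz
          rw [connectedComponent_eq_iff_mem.2 hpz] at hz
          exact hz mem_connectedComponent
        · rw [connectedComponent_eq_iff_mem.2 hpz]; exact mem_connectedComponent
      · rintro hz p ⟨hp, hpn⟩ hzp
        apply hpn
        rw [← connectedComponent_eq_iff_mem.2 hz, connectedComponent_eq_iff_mem.2 hzp]
        exact mem_connectedComponent
    rw [← heq]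
    apply hfin.isOpen_compl.mem_nhds
    rw [heq]; exact mem_connectedComponent
  refine ⟨(↑) '' connectedComponent x', ?_, ?_, ?_⟩
  · have hKn : K ∈ 𝓝 x := mem_of_superset (hUo.mem_nhds hxU) subset_closure
    have := Filter.image_mem_map (m := ((↑) : K → X)) hcomp
    have e : map ((↑) : K → X) (𝓝 x') = 𝓝 x :=
      map_nhds_subtype_coe_eq_nhds (mem_of_mem_nhds hKn) hKn
    rwa [e] at this
  · rintro _ ⟨p, _, rfl⟩
    exact hcl p.2
  · exact isPreconnected_connectedComponent.image _ continuous_subtype_val.continuousOn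

open Classical in
lemma aux_window {X : Type*} [MetricSpace X] [CompactSpace X] [ConnectedSpace X]
    (hX : IsRegCurve X) {f : X → X} (hf : IsMonotoneMap f)
    (hP : ∀ x : X, ¬ IsPeriodicPoint f x) {ε : ℝ} (hε : 0 < ε) :
    ∃ L : ℕ, 0 < L ∧ ∀ x : X, ∃ C ∈ 𝓝 x, ∃ n₀ : ℕ, ∀ n ≥ n₀,
      4 * ((Finset.Ico n (n + L)).filter
        fun j => ¬ ∀ y ∈ C, ∀ z ∈ C, dist (f^[j] y) (f^[j] z) < ε).card ≤ L := by
  obtain ⟨F, hF⟩ := aux_finite_set hX hε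
  refine ⟨4 * F.card + 4, by omega, ?_⟩
  set L := 4 * F.card + 4 with hL
  intro x
  have key : ∀ r ∈ Finset.Ico 1 L, ∃ η > 0, ∀ᶠ y in 𝓝 x, ∀ z, z ∈ {z | dist y (f^[r] z) > η} ∨ ¬ dist z x < η := by
    intro r hr
    have hr1 : 1 ≤ r := (Finset.mem_Ico.1 hr).1
    have hpos : 0 < dist x (f^[r] x) := by
      rw [dist_pos]
      intro h
      exact hP x ⟨r, hr1, h.symm⟩
    have hcont : Continuous (f^[r]) := hf.1.iterate r
    obtain ⟨δ, hδ, hδ'⟩ := Metric.continuousAt_iff.1 hcont.continuousAt (dist x (f^[r] x) / 4)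
      (by positivity)
    refine ⟨min δ (dist x (f^[r] x) / 4), by positivity, ?_⟩
    filter_upwards [ball_mem_nhds x (ε := dist x (f^[r] x) / 4) (by positivity)] with y hy z
    by_cases hz : dist z x < min δ (dist x (f^[r] x) / 4)
    · left
      have h1 := hδ' (lt_of_lt_of_le hz (min_le_left _ _))
      have h2 := mem_ball.1 hy
      have h3 := dist_triangle x y (f^[r] x)
      have h4 := dist_triangle y (f^[r] z) (f^[r] x)
      have h5 := min_le_right δ (dist x (f^[r] x) / 4)
      rw [dist_comm x y] at h3
      change dist y (f^[r] z) > _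
      linarith
    · right; exact hz
  choose! η hη hev using key
  obtain ⟨η₀, hη₀, hη₀'⟩ : ∃ η₀ > 0, ∀ r ∈ Finset.Ico 1 L, η₀ ≤ η r := by
    have : (Finset.Ico 1 L).Nonempty := ⟨1, by simp [hL]⟩
    obtain ⟨r, hr, hmin⟩ := Finset.exists_min_image _ η this
    exact ⟨η r, hη r hr, hmin⟩
  have hev' : ∀ᶠ y in 𝓝 x, ∀ r ∈ Finset.Ico 1 L, ∀ z,
      z ∈ {z | dist y (f^[r] z) > η r} ∨ ¬ dist z x < η r :=
    (Filter.eventually_all_finset _).2 hev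
  obtain ⟨C, hC, hCV, hCc⟩ := aux_locconn hX x _ (Filter.inter_mem hev' (ball_mem_nhds x hη₀))
  have hsm : ∀ᶠ n in atTop, ∀ p ∈ F, ∀ y z, f^[n] y = p → f^[n] z = p → dist y z < η₀ :=
    (Filter.eventually_all_finset _).2 fun p _ => aux_small_preimage hX hf hP p hη₀
  obtain ⟨n₀, hn₀⟩ := eventually_atTop.1 hsm
  refine ⟨C, hC, n₀, fun n hn => ?_⟩
  have hbad : ∀ j ∈ (Finset.Ico n (n + L)).filter
      (fun j => ¬ ∀ y ∈ C, ∀ z ∈ C, dist (f^[j] y) (f^[j] z) < ε), ∃ p ∈ F, ∃ y ∈ C, f^[j] y = p := by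
    intro j hj
    by_contra hno
    push Not at hno
    apply (Finset.mem_filter.1 hj).2
    intro y hy z hz
    refine hF (f^[j] '' C) (hCc.image _ (hf.1.iterate j).continuousOn) ?_ _ ⟨y, hy, rfl⟩ _ ⟨z, hz, rfl⟩
    rintro p hp ⟨w, hw, hwp⟩
    exact hno p hp w hw hwp
  choose! P hPF Y hYC hYP using hbad
  have hinj_aux : ∀ i j, i ∈ (Finset.Ico n (n + L)).filter
      (fun j => ¬ ∀ y ∈ C, ∀ z ∈ C, dist (f^[j] y) (f^[j] z) < ε) →
      j ∈ (Finset.Ico n (n + L)).filter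
      (fun j => ¬ ∀ y ∈ C, ∀ z ∈ C, dist (f^[j] y) (f^[j] z) < ε) → P i = P j → ¬ i < j := by
    intro i j hi hj hij hlt
    have hi' := Finset.mem_Ico.1 (Finset.mem_filter.1 hi).1
    have hj' := Finset.mem_Ico.1 (Finset.mem_filter.1 hj).1
    have hr : j - i ∈ Finset.Ico 1 L := by
      rw [Finset.mem_Ico]; omega
    have e1 : f^[i] (f^[j - i] (Y j)) = P i := by
      rw [← Function.iterate_add_apply, hij, ← hYP j hj]
      congr 2; omega
    have h1 := hn₀ i (by omega) (P i) (hPF i hi) _ _ (hYP i hi) e1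
    have h2 := hη₀' _ hr
    rcases (hCV (hYC i hi)).1 _ hr (Y j) with h | h
    · have h : dist (Y i) (f^[j - i] (Y j)) > η (j - i) := h
      linarith
    · apply h
      exact lt_of_lt_of_le (mem_ball.1 (hCV (hYC j hj)).2) h2
  have := Finset.card_le_card_of_injOn P hPF (fun i hi j hj hij => by
    rcases lt_trichotomy i j with h | h | h
    · exact (hinj_aux i j hi hj hij h).elim
    · exact h
    · exact (hinj_aux j i hj hi hij.symm h).elim)
  omega

lemma aux_minimal_exists {X : Type*} [TopologicalSpace X] [CompactSpace X] {f : X → X}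
    (A : Set X) (hA : A.Nonempty) (hAc : IsClosed A) (hAf : f '' A ⊆ A) :
    ∃ M ⊆ A, IsMinimalSet f M := by
  let S : Set (Set X) := {B | B.Nonempty ∧ IsClosed B ∧ f '' B ⊆ B}
  obtain ⟨M, hMA, hM⟩ := zorn_superset_nonempty S (by
    intro c hc hchain hne
    refine ⟨⋂₀ c, ⟨?_, ?_, ?_⟩, fun s hs => Set.sInter_subset_of_mem hs⟩
    · have : Nonempty c := hne.to_subtype
      exact IsCompact.nonempty_sInter_of_directed_nonempty_isCompact_isClosed
        (by
          intro a ha b hb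
          rcases hchain.total ha hb with h | h
          · exact ⟨a, ha, subset_rfl, h⟩
          · exact ⟨b, hb, h, subset_rfl⟩) (fun s hs => (hc hs).1)
        (fun s hs => (hc hs).2.1.isCompact) (fun s hs => (hc hs).2.1)
    · exact isClosed_sInter fun s hs => (hc hs).2.1
    · rintro _ ⟨x, hx, rfl⟩ s hs
      exact (hc hs).2.2 ⟨x, hx s hs, rfl⟩) A ⟨hA, hAc, hAf⟩
  refine ⟨M, hMA, hM.prop.1, hM.prop.2.1, hM.prop.2.2, ?_⟩
  intro B hBM hBn hBc hBf
  exact hM.eq_of_subset ⟨hBn, hBc, hBf⟩ hBM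

lemma aux_minimal_disjoint {X : Type*} [TopologicalSpace X] {f : X → X} {M N : Set X}
    (hM : IsMinimalSet f M) (hN : IsMinimalSet f N) (hne : M ≠ N) : Disjoint M N := by
  rw [Set.disjoint_iff_inter_eq_empty]
  by_contra h
  have hn : (M ∩ N).Nonempty := Set.nonempty_iff_ne_empty.2 h
  have hc : IsClosed (M ∩ N) := hM.2.1.inter hN.2.1
  have hi : f '' (M ∩ N) ⊆ M ∩ N := by
    rintro _ ⟨x, hx, rfl⟩
    exact ⟨hM.2.2.1 ⟨x, hx.1, rfl⟩, hN.2.2.1 ⟨x, hx.2, rfl⟩⟩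
  exact hne ((hM.2.2.2 _ Set.inter_subset_left hn hc hi).symm.trans
    (hN.2.2.2 _ Set.inter_subset_right hn hc hi))

/-- Basin of a set. -/
def auxBasin {X : Type*} [TopologicalSpace X] (f : X → X) (M : Set X) : Set X :=
  {x | M ⊆ closure (Set.range fun n : ℕ => f^[n] x)}

lemma aux_orbit_inv {X : Type*} [TopologicalSpace X] {f : X → X} (hf : Continuous f) (x : X) :
    f '' closure (Set.range fun n : ℕ => f^[n] x) ⊆ closure (Set.range fun n : ℕ => f^[n] x) := by
  refine (image_closure_subset_closure_image hf).trans (closure_mono ?_)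
  rintro _ ⟨_, ⟨n, rfl⟩, rfl⟩
  exact ⟨n + 1, Function.iterate_succ_apply' f n x⟩

open Classical in
/-- Closeness of neighbours of `x` and separation of basins. -/
lemma aux_nhds {X : Type*} [MetricSpace X] [CompactSpace X] [ConnectedSpace X]
    (hX : IsRegCurve X) {f : X → X} (hf : IsMonotoneMap f)
    (hP : ∀ x : X, ¬ IsPeriodicPoint f x) {M N : Set X}
    (hM : IsMinimalSet f M) (hN : IsMinimalSet f N) (hne : M ≠ N) (x : X) (hx : x ∈ auxBasin f M) :
    ∃ C ∈ 𝓝 x, ∀ y ∈ C, y ∉ auxBasin f N := by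
  obtain ⟨δ, hδ, hdisj⟩ := (aux_minimal_disjoint hM hN hne).exists_thickenings
    hM.2.1.isCompact hN.2.1
  obtain ⟨L, hL, hw⟩ := aux_window hX hf hP (ε := δ / 2) (by positivity)
  obtain ⟨C, hC, n₀, hn₀⟩ := hw x
  have basin : ∀ M : Set X, IsMinimalSet f M → ∀ x ∈ auxBasin f M, ∃ n₁ : ℕ, ∀ n ≥ n₁,
      4 * ((Finset.Ico n (n + L)).filter
        fun j => ¬ ∃ u ∈ M, dist (f^[j] x) u < δ / 2).card ≤ L := by
    intro M hM x hx
    obtain ⟨m, hm⟩ := hM.1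
    obtain ⟨C, hC, n₀, hn₀⟩ := hw m
    obtain ⟨_, haC, a, rfl⟩ := mem_closure_iff_nhds.1 (hx hm) C hC
    have hiter : ∀ j, f^[j] m ∈ M := by
      intro j
      induction j with
      | zero => exact hm
      | succ j ih =>
        rw [Function.iterate_succ_apply']
        exact hM.2.2.1 ⟨_, ih, rfl⟩
    refine ⟨n₀ + a, fun n hn => ?_⟩
    refine le_trans (Nat.mul_le_mul_left 4 ?_) (hn₀ (n - a) (by omega))
    refine Finset.card_le_card_of_injOn (fun j => j - a) ?_ ?_
    · intro j hj
      have hj := Finset.mem_filter.1 hj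
      have hj1 := Finset.mem_Ico.1 hj.1
      refine Finset.mem_coe.2 (Finset.mem_filter.2 ⟨Finset.mem_Ico.2 (by dsimp only; omega), ?_⟩)
      intro hall
      apply hj.2
      refine ⟨f^[j - a] m, hiter _, ?_⟩
      have := hall _ haC _ (mem_of_mem_nhds hC)
      rw [← Function.iterate_add_apply] at this
      have e : j - a + a = j := by omega
      rwa [e] at this
    · intro i hi j hj hij
      have hi1 := Finset.mem_Ico.1 (Finset.mem_filter.1 hi).1
      have hj1 := Finset.mem_Ico.1 (Finset.mem_filter.1 hj).1
      simp only at hij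
      omega
  refine ⟨C, hC, fun y hy hyN => ?_⟩
  obtain ⟨n₁, hn₁⟩ := basin M hM x hx
  obtain ⟨n₂, hn₂⟩ := basin N hN y hyN
  let n := n₀ + n₁ + n₂
  have b0 := hn₀ n (by omega)
  have b1 := hn₁ n (by omega)
  have b2 := hn₂ n (by omega)
  obtain ⟨j, hj, hj0, hj1, hj2⟩ : ∃ j ∈ Finset.Ico n (n + L),
      (∀ y ∈ C, ∀ z ∈ C, dist (f^[j] y) (f^[j] z) < δ / 2) ∧
      (∃ u ∈ M, dist (f^[j] x) u < δ / 2) ∧ (∃ u ∈ N, dist (f^[j] y) u < δ / 2) := by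
    by_contra hno
    have hsub : Finset.Ico n (n + L) ⊆
        ((Finset.Ico n (n + L)).filter
          fun j => ¬ ∀ y ∈ C, ∀ z ∈ C, dist (f^[j] y) (f^[j] z) < δ / 2) ∪
        ((Finset.Ico n (n + L)).filter fun j => ¬ ∃ u ∈ M, dist (f^[j] x) u < δ / 2) ∪
        ((Finset.Ico n (n + L)).filter fun j => ¬ ∃ u ∈ N, dist (f^[j] y) u < δ / 2) := by
      intro j hj
      simp only [Finset.mem_union, Finset.mem_filter]
      by_contra hcon
      apply hno
      refine ⟨j, hj, ?_, ?_, ?_⟩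
      · by_contra h; exact hcon (Or.inl (Or.inl ⟨hj, h⟩))
      · by_contra h; exact hcon (Or.inl (Or.inr ⟨hj, h⟩))
      · by_contra h; exact hcon (Or.inr ⟨hj, h⟩)
    have h1 := Finset.card_le_card hsub
    have h2 := h1.trans ((Finset.card_union_le _ _).trans
      (Nat.add_le_add_right (Finset.card_union_le _ _) _))
    rw [Nat.card_Ico] at h2
    omega
  obtain ⟨u, hu, hxu⟩ := hj1
  obtain ⟨v, hv, hyv⟩ := hj2
  have hxy := hj0 x (mem_of_mem_nhds hC) y hy
  have m1 : f^[j] y ∈ thickening δ M := by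
    refine mem_thickening_iff.2 ⟨u, hu, ?_⟩
    have := dist_triangle_left (f^[j] y) u (f^[j] x)
    linarith
  have m2 : f^[j] y ∈ thickening δ N := mem_thickening_iff.2 ⟨v, hv, by linarith⟩
  exact Set.disjoint_left.1 hdisj m1 m2

lemma aux_sierpinski {X : Type*} [MetricSpace X] [CompactSpace X] [ConnectedSpace X]
    (hlc : ∀ (x : X) (V : Set X), V ∈ 𝓝 x → ∃ C ∈ 𝓝 x, C ⊆ V ∧ IsPreconnected C)
    {ι : Type*} [Countable ι] (A : ι → Set X) (hA : ∀ i, IsClosed (A i))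
    (hcov : ∀ x, ∃ i, x ∈ A i) (hdisj : ∀ i j x, x ∈ A i → x ∈ A j → i = j) :
    ∃ i, A i = Set.univ := by
  let E : Set X := (⋃ i, interior (A i))ᶜ
  have hEc : IsClosed E := (isOpen_iUnion fun i => isOpen_interior).isClosed_compl
  by_cases hE : E.Nonempty
  · exfalso
    have : Nonempty E := hE.to_subtype
    have : CompactSpace E := isCompact_iff_compactSpace.1 hEc.isCompact
    obtain ⟨i, ⟨x, hx⟩⟩ := nonempty_interior_of_iUnion_of_closed
      (f := fun i => ((↑) : E → X) ⁻¹' A i)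
      (fun i => (hA i).preimage continuous_subtype_val) (by
        ext y
        simpa using hcov y)
    rw [mem_interior] at hx
    obtain ⟨O', hO'A, hO', hxO'⟩ := hx
    obtain ⟨O, hO, rfl⟩ := isOpen_induced_iff.1 hO'
    obtain ⟨C, hC, hCO, hCc⟩ := hlc x O (hO.mem_nhds hxO')
    have hxi : (x : X) ∈ A i := hO'A hxO'
    have hCA : C ⊆ A i := by
      intro z hz
      by_contra hzi
      obtain ⟨j, hj⟩ := hcov z
      have hij : i ≠ j := fun h => hzi (h ▸ hj)
      have hCj : C ⊆ interior (A j) ∪ (A j)ᶜ := by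
        intro w hw
        by_cases hwj : w ∈ A j
        · left
          by_contra hwn
          have hwE : w ∈ E := by
            intro hwU
            obtain ⟨k, hk⟩ := Set.mem_iUnion.1 hwU
            exact hwn (hdisj k j w (interior_subset hk) hwj ▸ hk)
          have : w ∈ A i := @hO'A ⟨w, hwE⟩ (hCO hw)
          exact hij (hdisj i j w this hwj)
        · exact Or.inr hwj
      have hzint : z ∈ interior (A j) := (hCj hz).resolve_right fun h => h hj
      have := hCc.subset_left_of_subset_union isOpen_interior (hA j).isOpen_compl
        (Set.disjoint_left.2 fun w h1 h2 => h2 (interior_subset h1)) hCj ⟨z, hz, hzint⟩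
      exact hij (hdisj i j x hxi (interior_subset (this (mem_of_mem_nhds hC))))
    exact x.2 (Set.mem_iUnion.2 ⟨i, mem_interior_iff_mem_nhds.2 (mem_of_superset hC hCA)⟩)
  · obtain ⟨x⟩ := (inferInstance : Nonempty X)
    obtain ⟨i, hi⟩ := hcov x
    refine ⟨i, ?_⟩
    have hop : IsOpen (A i) := by
      rw [← interior_eq_iff_isOpen]
      refine Set.Subset.antisymm interior_subset fun z hz => ?_
      have hzE : z ∉ E := fun h => hE ⟨z, h⟩
      obtain ⟨k, hk⟩ := Set.mem_iUnion.1 (not_not.1 hzE)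
      exact hdisj k i z (interior_subset hk) hz ▸ hk
    exact IsClopen.eq_univ ⟨hA i, hop⟩ ⟨x, hi⟩

theorem stmt_7 {X : Type*} [MetricSpace X] [CompactSpace X] [ConnectedSpace X]
    (hX : IsRegCurve X) (f : X → X) (hf : IsMonotoneMap f)
    (hP : ∀ x : X, ¬ IsPeriodicPoint f x) :
    (∃ M₀ : Set X, {M : Set X | IsMinimalSet f M} = {M₀}) ∨
      ¬ ({M : Set X | IsMinimalSet f M}).Countable := by
  by_cases hc : ({M : Set X | IsMinimalSet f M}).Countable
  swap
  · exact Or.inr hc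
  left
  have : Countable {M : Set X | IsMinimalSet f M} := hc.to_subtype
  have hcov : ∀ x, ∃ M : {M : Set X | IsMinimalSet f M}, x ∈ auxBasin f (M : Set X) := by
    intro x
    obtain ⟨M, hMA, hM⟩ := aux_minimal_exists (f := f)
      (closure (Set.range fun n : ℕ => f^[n] x)) (Set.range_nonempty _).closure isClosed_closure
      (aux_orbit_inv hf.1 x)
    exact ⟨⟨M, hM⟩, hMA⟩
  have hdisj : ∀ (M N : {M : Set X | IsMinimalSet f M}) (x : X),
      x ∈ auxBasin f (M : Set X) → x ∈ auxBasin f (N : Set X) → M = N := by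
    intro M N x hM hN
    by_contra hne
    obtain ⟨C, hC, h⟩ := aux_nhds hX hf hP M.2 N.2 (fun h => hne (Subtype.ext h)) x hM
    exact h x (mem_of_mem_nhds hC) hN
  have hclosed : ∀ M : {M : Set X | IsMinimalSet f M}, IsClosed (auxBasin f (M : Set X)) := by
    intro M
    rw [← isOpen_compl_iff, isOpen_iff_mem_nhds]
    intro x hx
    obtain ⟨N, hN⟩ := hcov x
    have hne : (N : Set X) ≠ M := fun h => hx (h ▸ hN)
    obtain ⟨C, hC, h⟩ := aux_nhds hX hf hP N.2 M.2 hne x hN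
    exact mem_of_superset hC h
  obtain ⟨M, hM⟩ := aux_sierpinski (aux_locconn hX) _ hclosed hcov hdisj
  refine ⟨M, ?_⟩
  ext N
  simp only [Set.mem_setOf_eq, Set.mem_singleton_iff]
  constructor
  · intro hN
    obtain ⟨x, hx⟩ := hN.1
    have horb : closure (Set.range fun n : ℕ => f^[n] x) ⊆ N := by
      refine closure_minimal ?_ hN.2.1
      rintro _ ⟨n, rfl⟩
      induction n with
      | zero => exact hx
      | succ n ih =>
        simp only [Function.iterate_succ_apply']
        exact hN.2.2.1 ⟨_, ih, rfl⟩
    have hxM : x ∈ auxBasin f (M : Set X) := by rw [hM]; trivial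
    exact (hN.2.2.2 _ (hxM.trans horb) M.2.1 M.2.2.1 M.2.2.2.1).symm
  · rintro rfl
    exact M.2
end

section
/- Let X be a regular curve and f : X → X a monotone continuous map with no periodic points (P(f) = ∅). Then only finitely many minimal sets of f are connected, i.e. the collection {M ⊆ X : M is a connected minimal set of f} is finite. -/
open Set Filter Metric Topology Function

theorem stmt_8 {X : Type*} [MetricSpace X] [CompactSpace X] [ConnectedSpace X]
    (hX : IsRegCurve X) (f : X → X) (hf : IsMonotoneMap f)
    (hP : ∀ x : X, ¬ IsPeriodicPoint f x) :
    {M : Set X | IsMinimalSet f M ∧ IsConnected M}.Finite := by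
  classical
  obtain ⟨hc, -⟩ := hf
  obtain ⟨x₀, hx₀⟩ : ∃ x₀ : X, ∀ x, dist x₀ (f x₀) ≤ dist x (f x) := by
    obtain ⟨x₀, -, h⟩ := isCompact_univ.exists_isMinOn (univ_nonempty (α := X))
      (f := fun x => dist x (f x)) (by fun_prop)
    exact ⟨x₀, fun x => h (mem_univ x)⟩
  have hε : 0 < dist x₀ (f x₀) := by
    rw [dist_pos]
    intro h
    exact hP x₀ ⟨1, le_rfl, h.symm⟩
  set ε := dist x₀ (f x₀) with hεd
  have key : ∀ x : X, ∃ U : Set X, IsOpen U ∧ x ∈ U ∧ U ⊆ ball x (ε / 2) ∧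
      (frontier U).Finite := fun x =>
    hX x (ball x (ε / 2)) isOpen_ball (mem_ball_self (by positivity))
  choose U hUo hxU hUb hUf using key
  obtain ⟨t, ht⟩ := isCompact_univ.elim_finite_subcover U hUo
    (fun x _ => mem_iUnion.2 ⟨x, hxU x⟩)
  have hF : (⋃ x ∈ t, frontier (U x)).Finite := t.finite_toSet.biUnion (fun x _ => hUf x)
  have hM : ∀ M ∈ {M : Set X | IsMinimalSet f M ∧ IsConnected M},
      ∃ p, p ∈ M ∧ p ∈ ⋃ x ∈ t, frontier (U x) := by
    rintro M ⟨⟨⟨y, hy⟩, -, hinv, -⟩, hconn⟩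
    obtain ⟨x, hxt, hyU⟩ := mem_iUnion₂.1 (ht (mem_univ y))
    have hfy : f y ∈ M := hinv ⟨y, hy, rfl⟩
    have hfU : f y ∉ U x := by
      intro h
      have h1 := mem_ball.1 (hUb x hyU)
      have h2 := mem_ball'.1 (hUb x h)
      have h3 := dist_triangle y x (f y)
      have h4 := hx₀ y
      linarith
    obtain ⟨p, hpM, hpF⟩ : (M ∩ frontier (U x)).Nonempty := by
      by_contra hne
      rw [not_nonempty_iff_eq_empty] at hne
      have hfr : ∀ p ∈ M, p ∉ frontier (U x) := fun p hp hq => by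
        have : p ∈ M ∩ frontier (U x) := ⟨hp, hq⟩
        simp [hne] at this
      obtain ⟨q, -, hq1, hq2⟩ := hconn.isPreconnected (U x) (closure (U x))ᶜ (hUo x)
        isClosed_closure.isOpen_compl
        (fun p hp => by
          by_cases h : p ∈ U x
          · exact Or.inl h
          · refine Or.inr fun hcl => hfr p hp ?_
            rw [(hUo x).frontier_eq]
            exact ⟨hcl, h⟩)
        ⟨y, hy, hyU⟩
        ⟨f y, hfy, fun hcl => hfr _ hfy (by rw [(hUo x).frontier_eq]; exact ⟨hcl, hfU⟩)⟩
      exact hq2 (subset_closure hq1)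
    exact ⟨p, hpM, mem_iUnion₂.2 ⟨x, hxt, hpF⟩⟩
  have : Nonempty X := ⟨x₀⟩
  choose! g hg hgF using hM
  refine Set.Finite.of_finite_image (f := g) (hF.subset ?_) ?_
  · rintro _ ⟨M, hM, rfl⟩
    exact hgF M hM
  · intro M hM N hN hMN
    have hgM := hg M hM
    have hgN := hg N hN
    rw [← hMN] at hgN
    obtain ⟨⟨-, hMc, hMi, hMm⟩, -⟩ := hM
    obtain ⟨⟨-, hNc, hNi, hNm⟩, -⟩ := hN
    have hi : f '' (M ∩ N) ⊆ M ∩ N := by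
      rintro _ ⟨z, hz, rfl⟩
      exact ⟨hMi ⟨z, hz.1, rfl⟩, hNi ⟨z, hz.2, rfl⟩⟩
    rw [← hMm _ inter_subset_left ⟨_, hgM, hgN⟩ (hMc.inter hNc) hi]
    exact hNm _ inter_subset_right ⟨_, hgM, hgN⟩ (hMc.inter hNc) hi
end

section
/- Let X be a compact metric space, f : X → X a continuous map, and (G_n)_{n ≥ 0} a sequence of nonempty compact subsets of X with diam(G_n) → 0 and f(G_{n+1}) ⊆ G_n for every n ≥ 0. Then limsup G_n = ⋂_{k ≥ 0} closure(⋃_{n ≥ k} G_n) is nonempty, closed, and strongly f-invariant: f(limsup G_n) = limsup G_n. -/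
open Set Filter Metric Topology Function

theorem mem_limsupSet_aux {X : Type*} [TopologicalSpace X] (G : ℕ → Set X)
    (m φ : ℕ → ℕ) (hm : ∀ j, j ≤ m j) (hφ : StrictMono φ) (w : ℕ → X)
    (hw : ∀ j, w j ∈ G (m j)) (a : X) (ha : Tendsto (w ∘ φ) atTop (𝓝 a)) :
    a ∈ limsupSet G := by
  refine mem_iInter.2 fun k => mem_closure_of_tendsto ha ?_
  filter_upwards [eventually_ge_atTop k] with j hj
  exact mem_biUnion (x := m (φ j)) (hj.trans ((hφ.id_le j).trans (hm _))) (hw _)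

theorem stmt_11 {X : Type*} [MetricSpace X] [CompactSpace X]
    (f : X → X) (hf : Continuous f) (G : ℕ → Set X)
    (hG : ∀ n, (G n).Nonempty ∧ IsCompact (G n))
    (hdiam : Filter.Tendsto (fun n => Metric.diam (G n)) Filter.atTop (𝓝 0))
    (hmap : ∀ n, f '' G (n + 1) ⊆ G n) :
    (limsupSet G).Nonempty ∧ IsClosed (limsupSet G) ∧
      f '' limsupSet G = limsupSet G := by
  choose x hx using fun n => (hG n).1
  refine ⟨?_, isClosed_iInter fun _ => isClosed_closure, Subset.antisymm ?_ ?_⟩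
  · obtain ⟨a, φ, hφ, ha⟩ := CompactSpace.tendsto_subseq x
    exact ⟨a, mem_limsupSet_aux G id φ (fun _ => le_rfl) hφ x hx a ha⟩
  · rintro _ ⟨a, ha, rfl⟩
    refine mem_iInter.2 fun k => ?_
    refine closure_mono ?_ (image_closure_subset_closure_image hf
      (mem_image_of_mem f (mem_iInter.1 ha (k + 1))))
    rintro _ ⟨z, hz, rfl⟩
    obtain ⟨n, hn, hz⟩ := mem_iUnion₂.1 hz
    have hn' : k + 1 ≤ n := hn
    obtain ⟨n, rfl⟩ : ∃ m, n = m + 1 := ⟨n - 1, by omega⟩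
    exact mem_biUnion (x := n) (show k ≤ n by omega) (hmap n (mem_image_of_mem f hz))
  · intro y hy
    have key : ∀ j : ℕ, ∃ n, j ≤ n ∧ ∃ z ∈ G n, dist y z < 1 / ((j : ℝ) + 1) := by
      intro j
      obtain ⟨z, hz, hd⟩ := Metric.mem_closure_iff.1 (mem_iInter.1 hy j) _
        (Nat.one_div_pos_of_nat (α := ℝ) (n := j))
      obtain ⟨n, hn, hz⟩ := mem_iUnion₂.1 hz
      exact ⟨n, hn, z, hz, hd⟩
    choose n hn z hz hd using key
    have hnt : Tendsto n atTop atTop := tendsto_atTop_mono hn tendsto_id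
    have hlim : Tendsto (fun j => f (x (n j + 1))) atTop (𝓝 y) := by
      have h0 : Tendsto (fun j : ℕ => Metric.diam (G (n j)) + 1 / ((j : ℝ) + 1))
          atTop (𝓝 0) := by
        simpa using (hdiam.comp hnt).add (tendsto_one_div_add_atTop_nhds_zero_nat (𝕜 := ℝ))
      rw [tendsto_iff_dist_tendsto_zero]
      refine squeeze_zero (fun _ => dist_nonneg) (fun j => ?_) h0
      have h1 := Metric.dist_le_diam_of_mem (hG (n j)).2.isBounded
        (hmap (n j) (mem_image_of_mem f (hx (n j + 1)))) (hz j)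
      have h2 := dist_triangle_right (f (x (n j + 1))) y (z j)
      linarith [hd j]
    obtain ⟨a, φ, hφ, ha⟩ := CompactSpace.tendsto_subseq (fun j => x (n j + 1))
    refine ⟨a, mem_limsupSet_aux G (fun j => n j + 1) φ (fun j => (hn j).trans (Nat.le_succ _))
      hφ _ (fun j => hx _) a ha, ?_⟩
    exact tendsto_nhds_unique ((hf.tendsto a).comp ha) (hlim.comp hφ.tendsto_atTop)
end

section
/- Let X be a compact metric space, f : X → X a continuous map, and x ∈ X_∞ = ⋂_{n ≥ 0} f^n(X). Then the α-limit set α_f(x) is nonempty, closed, and satisfies f(α_f(x)) ⊆ α_f(x). If moreover diam(f⁻ⁿ({x})) → 0 as n → ∞, then f(α_f(x)) = α_f(x). -/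
open Set Filter Metric Topology Function

theorem stmt_12 {X : Type*} [MetricSpace X] [CompactSpace X]
    (f : X → X) (hf : Continuous f) (x : X)
    (hx : x ∈ ⋂ n : ℕ, Set.range (f^[n])) :
    (alphaLimitSet f x).Nonempty ∧ IsClosed (alphaLimitSet f x) ∧
      f '' alphaLimitSet f x ⊆ alphaLimitSet f x ∧
      (Filter.Tendsto (fun n => Metric.diam (f^[n] ⁻¹' {x}))
          Filter.atTop (𝓝 0) →
        f '' alphaLimitSet f x = alphaLimitSet f x) := by
  have hU : ∀ k, IsClosed (closure (⋃ n ∈ Set.Ici k, f^[n] ⁻¹' {x})) := fun k => isClosed_closure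
  have hanti : ∀ k, closure (⋃ n ∈ Set.Ici (k+1), f^[n] ⁻¹' {x}) ⊆
      closure (⋃ n ∈ Set.Ici k, f^[n] ⁻¹' {x}) := by
    intro k
    apply closure_mono
    apply Set.biUnion_subset_biUnion_left
    intro n hn
    simp only [Set.mem_Ici] at *
    omega
  have hpt : ∀ n : ℕ, ∃ z, f^[n] z = x := fun n => Set.mem_iInter.1 hx n
  have hmem : ∀ (k n : ℕ) (z : X), k ≤ n → f^[n] z = x →
      z ∈ ⋃ n ∈ Set.Ici k, f^[n] ⁻¹' {x} := by
    intro k n z hk hz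
    exact Set.mem_biUnion (show n ∈ Set.Ici k from hk) hz
  have hsub : f '' alphaLimitSet f x ⊆ alphaLimitSet f x := by
    rintro _ ⟨y, hy, rfl⟩
    refine Set.mem_iInter.2 fun k => ?_
    have h1 := Set.mem_iInter.1 hy (k+1)
    refine map_mem_closure hf h1 ?_
    intro z hz
    obtain ⟨n, hn, hz⟩ := Set.mem_iUnion₂.1 hz
    obtain ⟨m, rfl⟩ : ∃ m, n = m + 1 :=
      ⟨n - 1, by simp only [Set.mem_Ici] at hn; omega⟩
    refine hmem k m _ (by simp only [Set.mem_Ici] at hn; omega) ?_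
    simpa [Function.iterate_succ_apply] using hz
  refine ⟨?_, isClosed_iInter hU, hsub, fun hd => hsub.antisymm ?_⟩
  · refine IsCompact.nonempty_iInter_of_sequence_nonempty_isCompact_isClosed _ hanti
      (fun k => ?_) (hU 0).isCompact hU
    obtain ⟨z, hz⟩ := hpt k
    exact ⟨z, subset_closure (hmem k k z le_rfl hz)⟩
  · intro y hy
    have key : ∀ k, ∃ z ∈ closure (⋃ n ∈ Set.Ici k, f^[n] ⁻¹' {x}), f z = y := by
      intro k
      have hc : IsClosed (f '' closure (⋃ n ∈ Set.Ici k, f^[n] ⁻¹' {x})) :=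
        ((hU k).isCompact.image hf).isClosed
      change y ∈ f '' closure (⋃ n ∈ Set.Ici k, f^[n] ⁻¹' {x})
      rw [← hc.closure_eq, Metric.mem_closure_iff]
      intro ε hε
      obtain ⟨N, hN⟩ := Filter.eventually_atTop.1
        (hd.eventually (gt_mem_nhds (half_pos hε)))
      obtain ⟨w, hw, hyw⟩ := Metric.mem_closure_iff.1
        (Set.mem_iInter.1 hy (max N k)) (ε/2) (half_pos hε)
      obtain ⟨n, hn, hw⟩ := Set.mem_iUnion₂.1 hw
      have hn' : max N k ≤ n := hn
      obtain ⟨z, hz⟩ := hpt (n+1)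
      refine ⟨f z, ⟨z, subset_closure (hmem k (n+1) z (by omega) hz), rfl⟩, ?_⟩
      have h1 : dist w (f z) ≤ Metric.diam (f^[n] ⁻¹' {x}) :=
        Metric.dist_le_diam_of_mem (isCompact_univ.isBounded.subset (Set.subset_univ _)) hw
          (by simpa [Function.iterate_succ_apply] using hz)
      have h2 := hN n (by omega)
      have h3 := dist_triangle y w (f z)
      linarith
    have hfc : IsClosed (f ⁻¹' {y}) := isClosed_singleton.preimage hf
    obtain ⟨z, hz⟩ := IsCompact.nonempty_iInter_of_sequence_nonempty_isCompact_isClosed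
      (fun k => closure (⋃ n ∈ Set.Ici k, f^[n] ⁻¹' {x}) ∩ f ⁻¹' {y})
      (fun k => Set.inter_subset_inter_left _ (hanti k))
      (fun k => by obtain ⟨z, h1, h2⟩ := key k; exact ⟨z, h1, h2⟩)
      ((hU 0).inter hfc).isCompact (fun k => (hU k).inter hfc)
    rw [Set.mem_iInter] at hz
    exact ⟨z, Set.mem_iInter.2 fun k => (hz k).1, (hz 0).2⟩
end

section
/- Let X be a regular curve and f : X → X a monotone continuous map. If x ∈ X_∞ = ⋂_{n ≥ 0} f^n(X) and the ω-limit set ω_f(x) is infinite, then ω_f(x) = α_f(x). -/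
open Set Filter Metric Topology Function

namespace S15

/-- boundary bumping -/
lemma bump {X : Type*} [MetricSpace X] [CompactSpace X] [ConnectedSpace X]
    {U : Set X} (hU : IsOpen U) (hF : (frontier U).Finite) (hne : (frontier U).Nonempty)
    {c : X} (hc : c ∈ closure U) :
    ∃ p ∈ frontier U, p ∈ connectedComponentIn (closure U) c := by
  by_contra! hcon
  have : CompactSpace (closure U) := isCompact_iff_compactSpace.1 isClosed_closure.isCompact
  have key : ∀ p ∈ frontier U, ∃ s : Set (closure U), IsClopen s ∧ ⟨c, hc⟩ ∈ s ∧
      ∀ h : p ∈ closure U, (⟨p, h⟩ : closure U) ∉ s := by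
    intro p hp
    have h1 := hcon p hp
    rw [connectedComponentIn_eq_image hc, connectedComponent_eq_iInter_isClopen] at h1
    have hp' : p ∈ closure U := frontier_subset_closure hp
    have h2 : (⟨p, hp'⟩ : closure U) ∉
        ⋂ s : { s : Set (closure U) // IsClopen s ∧ (⟨c, hc⟩ : closure U) ∈ s }, (s : Set (closure U)) :=
      fun h => h1 ⟨_, h, rfl⟩
    rw [mem_iInter] at h2
    push Not at h2
    obtain ⟨s, hs⟩ := h2
    exact ⟨s, s.2.1, s.2.2, fun _ => hs⟩
  choose! s hs1 hs2 hs3 using key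
  set Q : Set (closure U) := ⋂ p ∈ frontier U, s p with hQ
  have hQc : IsClopen Q := hF.isClopen_biInter hs1
  have hcQ : (⟨c, hc⟩ : closure U) ∈ Q := mem_iInter₂.2 hs2
  have hQU : ∀ q ∈ Q, (q : X) ∈ U := by
    intro q hq
    by_contra hqU
    have : (q : X) ∈ frontier U := by
      rw [hU.frontier_eq]; exact ⟨q.2, hqU⟩
    exact hs3 _ this q.2 (mem_iInter₂.1 hq _ this)
  have hcl : IsClosed (Subtype.val '' Q) := isClosed_closure.isClosedEmbedding_subtypeVal.isClosedMap _ hQc.1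
  have hop : IsOpen (Subtype.val '' Q) := by
    obtain ⟨O, hO, hOQ⟩ := isOpen_induced_iff.1 hQc.2
    have : Subtype.val '' Q = O ∩ U := by
      ext z
      constructor
      · rintro ⟨q, hq, rfl⟩
        exact ⟨by rw [← hOQ] at hq; exact hq, hQU q hq⟩
      · rintro ⟨h1, h2⟩
        exact ⟨⟨z, subset_closure h2⟩, by rw [← hOQ]; exact h1, rfl⟩
    rw [this]; exact hO.inter hU
  have huniv : Subtype.val '' Q = univ := IsClopen.eq_univ ⟨hcl, hop⟩ ⟨c, _, hcQ, rfl⟩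
  obtain ⟨p, hp⟩ := hne
  have : p ∈ Subtype.val '' Q := by rw [huniv]; trivial
  obtain ⟨q, hq, rfl⟩ := this
  have h3 := hQU q hq
  rw [hU.frontier_eq] at hp
  exact hp.2 h3

lemma isClosed_cc {X : Type*} [TopologicalSpace X] {F : Set X} (hF : IsClosed F) (x : X) :
    IsClosed (connectedComponentIn F x) := by
  by_cases h : x ∈ F
  · rw [connectedComponentIn_eq_image h]
    exact hF.isClosedEmbedding_subtypeVal.isClosedMap _ isClosed_connectedComponent
  · rw [connectedComponentIn_eq_empty h]; exact isClosed_empty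

lemma loc_conn {X : Type*} [MetricSpace X] [CompactSpace X] [ConnectedSpace X]
    (hX : IsRegCurve X) {x : X} {V : Set X} (hV : IsOpen V) (hx : x ∈ V) :
    ∃ C : Set X, IsPreconnected C ∧ C ∈ 𝓝 x ∧ C ⊆ V := by
  obtain ⟨r, hr, hrV⟩ := Metric.isOpen_iff.1 hV x hx
  obtain ⟨U, hU, hxU, hUV, hF⟩ := hX x (Metric.ball x (r/2)) Metric.isOpen_ball
    (Metric.mem_ball_self (by positivity))
  have hKV : closure U ⊆ V := by
    refine (closure_mono hUV).trans ((Metric.closure_ball_subset_closedBall).trans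
      ((Metric.closedBall_subset_ball (by linarith)).trans hrV))
  have hxK := subset_closure hxU
  by_cases hne : (frontier U).Nonempty
  · refine ⟨connectedComponentIn (closure U) x, isPreconnected_connectedComponentIn, ?_,
      (connectedComponentIn_subset _ _).trans hKV⟩
    set C := connectedComponentIn (closure U) x with hC
    have hFC : (frontier U \ C).Finite := hF.subset sdiff_subset
    have hcl : IsClosed (⋃ p ∈ frontier U \ C, connectedComponentIn (closure U) p) :=
      hFC.isClosed_biUnion fun p _ => isClosed_cc isClosed_closure p
    have hopen := hU.sdiff hcl
    refine Filter.mem_of_superset (hopen.mem_nhds ⟨hxU, ?_⟩) ?_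
    · intro h
      obtain ⟨p, hp, hxp⟩ := mem_iUnion₂.1 h
      have := connectedComponentIn_eq hxp
      apply hp.2
      rw [hC, ← this]
      exact mem_connectedComponentIn (frontier_subset_closure hp.1)
    · rintro q ⟨hqU, hq⟩
      by_contra hqC
      obtain ⟨p, hp, hpq⟩ := bump hU hF hne (subset_closure hqU)
      have e := connectedComponentIn_eq hpq
      apply hq
      refine mem_iUnion₂.2 ⟨p, ⟨hp, ?_⟩, ?_⟩
      · intro hpC
        have e2 := connectedComponentIn_eq hpC
        apply hqC
        rw [hC, e2, ← e]
        exact mem_connectedComponentIn (subset_closure hqU)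
      · rw [← e]; exact mem_connectedComponentIn (subset_closure hqU)
  · rw [not_nonempty_iff_eq_empty, ← isClopen_iff_frontier_eq_empty] at hne
    have : U = univ := hne.eq_univ ⟨x, hxU⟩
    refine ⟨univ, isPreconnected_univ, univ_mem, ?_⟩
    rw [← this]; exact subset_closure.trans hKV

lemma fin_nhd {X : Type*} [MetricSpace X] [CompactSpace X]
    (hX : IsRegCurve X) {A V : Set X} (hA : IsClosed A) (hV : IsOpen V) (hAV : A ⊆ V) :
    ∃ N : Set X, IsOpen N ∧ A ⊆ N ∧ N ⊆ V ∧ (frontier N).Finite := by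
  refine hA.isCompact.induction_on (p := fun A => ∃ N : Set X, IsOpen N ∧ A ⊆ N ∧ N ⊆ V ∧ (frontier N).Finite)
    ⟨∅, isOpen_empty, subset_rfl, empty_subset _, by simp⟩ ?_ ?_ ?_
  · rintro s t hst ⟨N, h1, h2, h3⟩
    exact ⟨N, h1, hst.trans h2, h3⟩
  · rintro s t ⟨N, h1, h2, h3, h4⟩ ⟨M, k1, k2, k3, k4⟩
    refine ⟨N ∪ M, h1.union k1, union_subset_union h2 k2, union_subset h3 k3, ?_⟩
    refine (h4.union k4).subset ((frontier_union_subset N M).trans ?_)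
    exact union_subset_union inter_subset_left inter_subset_right
  · intro x hx
    obtain ⟨U, hU, hxU, hUV, hF⟩ := hX x V hV (hAV hx)
    exact ⟨U, mem_nhdsWithin_of_mem_nhds (hU.mem_nhds hxU), U, hU, subset_rfl, hUV, hF⟩

lemma meets {X : Type*} [TopologicalSpace X] {C N : Set X} (hN : IsOpen N) (hC : IsPreconnected C)
    {a b : X} (ha : a ∈ C) (haN : a ∈ N) (hb : b ∈ C) (hbN : b ∉ N) : ∃ p ∈ C, p ∈ frontier N := by
  by_contra! h
  have hcov : C ⊆ N ∪ (closure N)ᶜ := by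
    intro z hz
    by_cases h1 : z ∈ N
    · exact Or.inl h1
    · right
      intro h2
      apply h z hz
      rw [hN.frontier_eq]; exact ⟨h2, h1⟩
  obtain ⟨z, -, hz1, hz2⟩ := hC N (closure N)ᶜ hN isClosed_closure.isOpen_compl hcov ⟨a, ha, haN⟩
    ⟨b, hb, (hcov hb).resolve_left hbN⟩
  exact hz2 (subset_closure hz1)

/-- counting principle -/
lemma GP {X ι : Type*} [TopologicalSpace X] {N : Set X} (hN : IsOpen N) (hF : (frontier N).Finite)
    (S : Finset ι) (hS : hF.toFinset.card < S.card) (T : ι → Set X)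
    (hT : ∀ i ∈ S, IsPreconnected (T i))
    (hd : ∀ i ∈ S, ∀ j ∈ S, i ≠ j → Disjoint (T i) (T j))
    (hin : ∀ i ∈ S, ∃ a ∈ T i, a ∈ N) (hout : ∀ i ∈ S, ∃ a ∈ T i, a ∉ N) : False := by
  have : ∀ i ∈ S, ∃ p ∈ T i, p ∈ frontier N := by
    intro i hi
    obtain ⟨a, ha, haN⟩ := hin i hi
    obtain ⟨b, hb, hbN⟩ := hout i hi
    exact meets hN (hT i hi) ha haN hb hbN
  have hp : ∀ i : ι, ∃ p : X, i ∈ S → p ∈ T i ∧ p ∈ frontier N := by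
    intro i
    by_cases hi : i ∈ S
    · obtain ⟨p, h⟩ := this i hi
      exact ⟨p, fun _ => h⟩
    · obtain ⟨i', hi'⟩ := Finset.card_pos.1 (lt_of_le_of_lt (Nat.zero_le _) hS)
      obtain ⟨p, h⟩ := this i' hi'
      exact ⟨p, fun h => absurd h hi⟩
  choose p hp using hp
  obtain ⟨i, hi, j, hj, hij, e⟩ := Finset.exists_ne_map_eq_of_card_lt_of_maps_to hS (f := p)
    (fun i hi => by simpa using (hp i hi).2)
  exact Set.disjoint_left.1 (hd i hi j hj hij) (hp i hi).1 (e ▸ (hp j hj).1)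

/-- disjoint connected neighbourhoods -/
lemma disj_nhds {X ι : Type*} [MetricSpace X] [CompactSpace X] [ConnectedSpace X]
    (hX : IsRegCurve X) (S : Finset ι) (y : ι → X) (hy : Set.InjOn y S) :
    ∃ C : ι → Set X, (∀ i, IsPreconnected (C i)) ∧ (∀ i, C i ∈ 𝓝 (y i)) ∧
      ∀ i ∈ S, ∀ j ∈ S, i ≠ j → Disjoint (C i) (C j) := by
  classical
  obtain ⟨U, hU, hUd⟩ := (S.image y).finite_toSet.t2_separation
  have := fun i => loc_conn hX (hU (y i)).2 (hU (y i)).1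
  choose C h1 h2 h3 using this
  refine ⟨C, h1, h2, fun i hi j hj hij => ?_⟩
  refine (hUd ?_ ?_ ?_).mono (h3 i) (h3 j)
  · simpa using ⟨i, hi, rfl⟩
  · simpa using ⟨j, hj, rfl⟩
  · exact fun h => hij (hy hi hj h)

section dyn
set_option linter.unusedSectionVars false
variable {X : Type*} [MetricSpace X] {f : X → X} {x : X}

lemma mem_om {y : X} : y ∈ omegaLimitSet f x ↔ ∀ V ∈ 𝓝 y, ∀ n : ℕ, ∃ k, n ≤ k ∧ f^[k] x ∈ V := by
  unfold omegaLimitSet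
  simp only [mem_iInter, mem_closure_iff_nhds]
  constructor
  · intro h V hV n
    obtain ⟨z, hz, k, hk, rfl⟩ := h n V hV
    exact ⟨k, hk, hz⟩
  · intro h n V hV
    obtain ⟨k, hk, hz⟩ := h V hV n
    exact ⟨_, hz, k, hk, rfl⟩

lemma mem_al {y : X} : y ∈ alphaLimitSet f x ↔
    ∀ V ∈ 𝓝 y, ∀ n : ℕ, ∃ k u, n ≤ k ∧ u ∈ V ∧ f^[k] u = x := by
  unfold alphaLimitSet
  simp only [mem_iInter, mem_closure_iff_nhds]
  constructor
  · intro h V hV n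
    obtain ⟨z, hz, hz2⟩ := h n V hV
    obtain ⟨k, hk, hk2⟩ := mem_iUnion₂.1 hz2
    exact ⟨k, z, hk, hz, hk2⟩
  · intro h n V hV
    obtain ⟨k, u, hk, hu, e⟩ := h V hV n
    exact ⟨u, hu, mem_iUnion₂.2 ⟨k, hk, e⟩⟩

lemma om_closed : IsClosed (omegaLimitSet f x) := isClosed_iInter fun _ => isClosed_closure
lemma al_closed : IsClosed (alphaLimitSet f x) := isClosed_iInter fun _ => isClosed_closure

lemma om_inv (hc : Continuous f) {y : X} (hy : y ∈ omegaLimitSet f x) : f y ∈ omegaLimitSet f x := by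
  rw [mem_om] at hy ⊢
  intro V hV n
  obtain ⟨k, hk, h⟩ := hy _ (hc.continuousAt hV) n
  exact ⟨k + 1, by omega, by rw [iterate_succ_apply']; exact h⟩

lemma al_inv (hc : Continuous f) {y : X} (hy : y ∈ alphaLimitSet f x) : f y ∈ alphaLimitSet f x := by
  rw [mem_al] at hy ⊢
  intro V hV n
  obtain ⟨k, u, hk, h, e⟩ := hy _ (hc.continuousAt hV) (n + 1)
  obtain ⟨k, rfl⟩ : ∃ k', k = k' + 1 := ⟨k - 1, by omega⟩
  exact ⟨k, f u, by omega, h, by rw [← iterate_succ_apply]; exact e⟩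

lemma iter_inv {A : Set X} (hA : ∀ a ∈ A, f a ∈ A) {a : X} (ha : a ∈ A) (k : ℕ) : f^[k] a ∈ A := by
  induction k with
  | zero => exact ha
  | succ k ih => rw [iterate_succ_apply']; exact hA _ ih

lemma pre_conn (hf : IsMonotoneMap f) (k : ℕ) {C : Set X} (hC : IsPreconnected C) :
    IsPreconnected (f^[k] ⁻¹' C) := by
  induction k with
  | zero => exact hC
  | succ k ih =>
    have : f^[k+1] ⁻¹' C = f ⁻¹' (f^[k] ⁻¹' C) := by
      ext z; simp
    rw [this]; exact hf.2 _ ih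

lemma al_nonempty [CompactSpace X] (hx : x ∈ ⋂ n : ℕ, Set.range (f^[n])) :
    (alphaLimitSet f x).Nonempty := by
  simp only [mem_iInter, mem_range] at hx
  choose u hu using hx
  obtain ⟨a, φ, hφ, h⟩ := CompactSpace.tendsto_subseq u
  refine ⟨a, mem_al.2 fun V hV n => ?_⟩
  obtain ⟨j, hj, hj2⟩ := ((h.eventually hV).and (eventually_ge_atTop n)).exists
  exact ⟨φ j, u (φ j), hj2.trans (hφ.id_le j), hj, hu _⟩

/-- limits of backward pieces of the orbit -/
lemma back_lim [CompactSpace X] (hc : Continuous f) (e : ℕ → ℕ) (he : ∀ h, h ≤ e h) :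
    ∃ y : ℕ → X, (∀ i, f (y (i+1)) = y i) ∧ (∀ i, y i ∈ omegaLimitSet f x) ∧
      ∀ i, ∀ K : Set X, IsClosed K → (∀ᶠ h in atTop, f^[e h - i] x ∈ K) → y i ∈ K := by
  obtain ⟨y, φ, hφ, h⟩ := CompactSpace.tendsto_subseq (fun h : ℕ => fun i : ℕ => f^[e h - i] x)
  rw [tendsto_pi_nhds] at h
  refine ⟨y, fun i => ?_, fun i => mem_om.2 fun V hV n => ?_, fun i K hK hh => ?_⟩
  · refine tendsto_nhds_unique ((hc.tendsto _).comp (h (i+1))) ((h i).congr' ?_)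
    filter_upwards [eventually_ge_atTop (i+1)] with j hj
    have := he (φ j)
    have := hφ.id_le j
    simp only [id] at this
    simp only [comp]
    rw [← iterate_succ_apply' f]
    congr 2
    omega
  · obtain ⟨j, hj, hj2⟩ := (((h i).eventually hV).and (eventually_ge_atTop (n+i))).exists
    have := he (φ j)
    have := hφ.id_le j
    simp only [id] at this
    exact ⟨e (φ j) - i, by omega, hj⟩
  · exact hK.mem_of_tendsto (h i) (hφ.tendsto_atTop.eventually hh)

lemma back_orbit [CompactSpace X] (hc : Continuous f) {z : X} (hz : z ∈ omegaLimitSet f x) :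
    ∃ y : ℕ → X, y 0 = z ∧ (∀ i, f (y (i+1)) = y i) ∧ (∀ i, y i ∈ omegaLimitSet f x) := by
  have hz' := mem_om.1 hz
  have : ∀ h : ℕ, ∃ k, h ≤ k ∧ f^[k] x ∈ Metric.ball z (1/(h+1)) := fun h =>
    hz' _ (Metric.ball_mem_nhds _ (by positivity)) h
  choose e he1 he2 using this
  obtain ⟨y, h1, h2, h3⟩ := back_lim (x := x) hc e he1
  refine ⟨y, ?_, h1, h2⟩
  refine eq_of_forall_dist_le fun ε hε => ?_
  refine h3 0 (Metric.closedBall z ε) Metric.isClosed_closedBall ?_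
  obtain ⟨n, hn⟩ := exists_nat_one_div_lt hε
  filter_upwards [eventually_ge_atTop n] with h hh
  have a1 := he2 h
  rw [Metric.mem_ball] at a1
  have a2 : (1:ℝ)/(h+1) ≤ 1/(n+1) := by gcongr
  rw [Metric.mem_closedBall, Nat.sub_zero]
  linarith

lemma om_pre [CompactSpace X] (hc : Continuous f) {z : X} (hz : z ∈ omegaLimitSet f x) (k : ℕ) :
    ∃ y ∈ omegaLimitSet f x, f^[k] y = z := by
  obtain ⟨y, h0, h1, h2⟩ := back_orbit hc hz
  refine ⟨y k, h2 k, ?_⟩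
  rw [← h0]
  clear h0
  induction k with
  | zero => rfl
  | succ k ih => rw [iterate_succ_apply, h1, ih]

lemma back_iter {y : ℕ → X} (h1 : ∀ i, f (y (i+1)) = y i) (i k : ℕ) : f^[k] (y (i+k)) = y i := by
  induction k with
  | zero => rfl
  | succ k ih => rw [iterate_succ_apply, ← add_assoc, h1, ih]

lemma disj_pre {C D : Set X} (h : Disjoint C D) (k : ℕ) : Disjoint (f^[k] ⁻¹' C) (f^[k] ⁻¹' D) :=
  h.preimage _

variable [CompactSpace X] [ConnectedSpace X]

/-- Key: windows near an `α`-invariant set. -/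
lemma lemP (hX : IsRegCurve X) (hf : IsMonotoneMap f) {N : Set X} (hN : IsOpen N)
    (hF : (frontier N).Finite) {a : X} (ha : a ∈ alphaLimitSet f x) (haN : ∀ i, f^[i] a ∈ N)
    {Y : Set X} (hY : Y ⊆ omegaLimitSet f x)
    (hYT : ∀ S : Finset X, (S : Set X) ⊆ Y → ∃ T : ℕ, 0 < T ∧ ∀ k, T ∣ k → ∀ v ∈ S, ∃ v', v' ∉ N ∧ f^[k] v' = v) :
    Y.Finite := by
  by_contra hinf
  obtain ⟨S, hSY, hS⟩ := Set.Infinite.exists_subset_card_eq hinf (hF.toFinset.card + 1)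
  obtain ⟨T, hT, hpre⟩ := hYT S hSY
  obtain ⟨C, hC1, hC2, hC3⟩ := disj_nhds hX S id (injOn_id _)
  have : ∀ v : X, ∃ n, v ∈ S → f^[n] x ∈ C v := by
    intro v
    by_cases hv : v ∈ S
    · obtain ⟨n, -, hn⟩ := mem_om.1 (hY (hSY hv)) (C v) (hC2 v) 0
      exact ⟨n, fun _ => hn⟩
    · exact ⟨0, fun h => absurd h hv⟩
  choose n hn using this
  set h := S.sup n + T
  have hnb : (⋂ i ∈ Finset.range (h+1), f^[i] ⁻¹' N) ∈ 𝓝 a := by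
    rw [Filter.biInter_finset_mem]
    intro i _
    exact (hf.1.iterate i).continuousAt (hN.mem_nhds (haN i))
  obtain ⟨l, u, -, hu, hux⟩ := mem_al.1 ha _ hnb 0
  have hu' : ∀ i ≤ h, f^[i] u ∈ N := fun i hi =>
    mem_iInter₂.1 hu i (Finset.mem_range.2 (by omega))
  have hlr := Nat.mod_add_div l T
  have hr := Nat.mod_lt l hT
  set k := T * (l / T)
  refine GP hN hF S (by omega) (fun v => f^[k] ⁻¹' C v) (fun v _ => pre_conn hf k (hC1 v))
    (fun i hi j hj hij => disj_pre (hC3 i hi j hj hij) k) (fun v hv => ?_) (fun v hv => ?_)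
  · have hsup := Finset.le_sup (f := n) hv
    refine ⟨f^[n v + l % T] u, ?_, hu' _ (by omega)⟩
    rw [mem_preimage, ← iterate_add_apply]
    have : k + (n v + l % T) = n v + l := by omega
    rw [this, iterate_add_apply, hux]
    exact hn v hv
  · obtain ⟨v', h1, h2⟩ := hpre k ⟨_, rfl⟩ v hv
    exact ⟨v', by rw [mem_preimage, h2]; exact mem_of_mem_nhds (hC2 v), h1⟩

lemma lemE1 (hX : IsRegCurve X) (hf : IsMonotoneMap f) {y : ℕ → X} (hinj : Injective y)
    (h1 : ∀ i, f (y (i+1)) = y i) (h2 : ∀ i, y i ∈ omegaLimitSet f x) (L : ℕ) :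
    ∃ (n : ℕ) (C : ℕ → Set X), (∀ i, IsPreconnected (C i)) ∧ (∀ i, y i ∈ C i) ∧
      (∀ i ≤ L, f^[n + L - i] x ∈ C i) ∧ ∀ i ≤ L, ∀ j ≤ L, i ≠ j → Disjoint (C i) (C j) := by
  obtain ⟨C, hC1, hC2, hC3⟩ := disj_nhds hX (Finset.range (L+1)) y hinj.injOn
  have hnb : (⋂ i ∈ Finset.range (L+1), f^[L-i] ⁻¹' (C i)) ∈ 𝓝 (y L) := by
    rw [Filter.biInter_finset_mem]
    intro i hi
    have hi' : i ≤ L := by have := Finset.mem_range.1 hi; omega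
    refine (hf.1.iterate _).continuousAt ?_
    have := back_iter h1 i (L - i)
    rw [show i + (L - i) = L by omega] at this
    rw [this]; exact hC2 i
  obtain ⟨n, -, hn⟩ := mem_om.1 (h2 L) _ hnb 0
  refine ⟨n, C, hC1, fun i => mem_of_mem_nhds (hC2 i), fun i hi => ?_, fun i hi j hj =>
    hC3 i (Finset.mem_range.2 (by omega)) j (Finset.mem_range.2 (by omega))⟩
  have := mem_iInter₂.1 hn i (Finset.mem_range.2 (by omega))
  rw [mem_preimage, ← iterate_add_apply] at this
  rwa [show n + L - i = L - i + n by omega]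

lemma lemE_fwd (hX : IsRegCurve X) (hf : IsMonotoneMap f) {y : ℕ → X} (hinj : Injective y)
    (h1 : ∀ i, f (y (i+1)) = y i) (h2 : ∀ i, y i ∈ omegaLimitSet f x)
    {N : Set X} (hN : IsOpen N) (hF : (frontier N).Finite) (hy : ∀ i, y i ∈ N) :
    {l : ℕ | f^[l] x ∉ N}.Finite := by
  by_contra hinf
  obtain ⟨S, hSY, hS⟩ := Set.Infinite.exists_subset_card_eq hinf (hF.toFinset.card + 1)
  have hle : ∀ l ∈ S, l ≤ S.sup id := fun l hl => Finset.le_sup (f := id) hl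
  obtain ⟨n, C, hC1, hC2, hC3, hC4⟩ := lemE1 hX hf hinj h1 h2 (S.sup id)
  set L := S.sup id
  refine GP hN hF S (by omega) (fun l => f^[n] ⁻¹' C (L - l)) (fun v _ => pre_conn hf n (hC1 _))
    (fun i hi j hj hij => disj_pre (hC4 _ (by omega) _ (by omega) ?_) n) (fun v hv => ?_) (fun v hv => ?_)
  · have := hle i hi
    have := hle j hj
    omega
  · exact ⟨y (L - v + n), by rw [mem_preimage, back_iter h1]; exact hC2 _, hy _⟩
  · refine ⟨f^[v] x, ?_, hSY hv⟩
    have := hC3 (L - v) (by omega)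
    have h := hle v hv
    rw [mem_preimage, ← iterate_add_apply]
    rwa [show n + L - (L - v) = n + v by omega] at this

lemma lemE_bwd (hX : IsRegCurve X) (hf : IsMonotoneMap f) {y : ℕ → X} (hinj : Injective y)
    (h1 : ∀ i, f (y (i+1)) = y i) (h2 : ∀ i, y i ∈ omegaLimitSet f x)
    {N : Set X} (hN : IsOpen N) (hF : (frontier N).Finite) (hy : ∀ i, y i ∈ N) :
    {l : ℕ | ∃ u, f^[l] u = x ∧ u ∉ N}.Finite := by
  by_contra hinf
  obtain ⟨S, hSY, hS⟩ := Set.Infinite.exists_subset_card_eq hinf (hF.toFinset.card + 1)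
  have hle : ∀ l ∈ S, l ≤ S.sup id := fun l hl => Finset.le_sup (f := id) hl
  obtain ⟨n, C, hC1, hC2, hC3, hC4⟩ := lemE1 hX hf hinj h1 h2 (S.sup id)
  set L := S.sup id
  refine GP hN hF S (by omega) (fun l => f^[n + L] ⁻¹' C l) (fun v _ => pre_conn hf _ (hC1 _))
    (fun i hi j hj hij => disj_pre (hC4 _ (hle i hi) _ (hle j hj) hij) _) (fun v hv => ?_) (fun v hv => ?_)
  · exact ⟨y (v + (n + L)), by rw [mem_preimage, back_iter h1]; exact hC2 _, hy _⟩
  · obtain ⟨u, hu, huN⟩ := hSY hv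
    refine ⟨u, ?_, huN⟩
    have h := hle v hv
    have := hC3 v h
    rw [mem_preimage, show n + L = n + L - v + v by omega, iterate_add_apply, hu]
    exact this

/-- A backward orbit of a nonperiodic point consists of distinct points. -/
lemma back_inj {y : ℕ → X} (h1 : ∀ i, f (y (i+1)) = y i) (h0 : ¬ IsPeriodicPoint f (y 0)) :
    Injective y := by
  have key : ∀ i d, y i ≠ y (i + (d + 1)) := by
    intro i d e
    apply h0
    refine ⟨d + 1, by omega, ?_⟩
    have a := back_iter h1 i (d+1)
    rw [← e] at a
    have b := back_iter h1 0 i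
    rw [zero_add] at b
    rw [← b, ← iterate_add_apply, add_comm, iterate_add_apply, a]
  intro i j e
  rcases lt_trichotomy i j with h | h | h
  · obtain ⟨d, rfl⟩ := Nat.exists_eq_add_of_lt h
    exact absurd e (key i d)
  · exact h
  · obtain ⟨d, rfl⟩ := Nat.exists_eq_add_of_lt h
    exact absurd e.symm (key j d)

lemma lemP3 (hX : IsRegCurve X) (hf : IsMonotoneMap f) {A : Set X} (hA : IsClosed A)
    (hne : A.Nonempty) (hAo : A ⊆ omegaLimitSet f x) (hAi : ∀ a ∈ A, f a ∈ A)
    (hper : ∀ N : Set X, IsOpen N → A ⊆ N → (frontier N).Finite →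
      {v ∈ omegaLimitSet f x | IsPeriodicPoint f v ∧ v ∉ N}.Finite) :
    omegaLimitSet f x ⊆ A := by
  by_contra hnot
  obtain ⟨z, hz, hzA⟩ := not_subset.1 hnot
  set d : X → ℝ := fun v => Metric.infDist v A with hd
  have hdc : Continuous d := Metric.continuous_infDist_pt A
  have hdA : ∀ a ∈ A, d a = 0 := fun a ha => Metric.infDist_zero_of_mem ha
  have hdz : 0 < d z := (hA.notMem_iff_infDist_pos hne).1 hzA
  -- choice of the radius
  obtain ⟨N0, hN0, hAN0, hN0d, hN0F⟩ := fin_nhd hX hA (isOpen_lt hdc (continuous_const (y := d z / 3)))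
    (fun a ha => by simp only [mem_setOf_eq, hdA a ha]; linarith)
  have hfin := (hper N0 hN0 hAN0 hN0F).image d
  obtain ⟨r, ⟨hr1, hr2⟩, hr3⟩ := ((Set.Ioo_infinite (show d z / 3 < d z / 2 by linarith)).sdiff hfin).nonempty
  have hrper : ∀ v ∈ omegaLimitSet f x, IsPeriodicPoint f v → d v ≠ r := by
    intro v hv hp e
    apply hr3
    refine ⟨v, ⟨hv, hp, fun h => ?_⟩, e⟩
    have : d v < d z / 3 := hN0d h
    linarith
  have hrpos : 0 < r := by linarith
  obtain ⟨a, ha⟩ := hne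
  have hex : ∀ h : ℕ, ∃ e, h ≤ e ∧ r < d (f^[e] x) ∧ ∀ i, 1 ≤ i → i ≤ h → d (f^[e - i] x) ≤ r := by
    intro h
    have hnb : (⋂ i ∈ Finset.range (h+1), f^[i] ⁻¹' {v | d v < r}) ∈ 𝓝 a := by
      rw [Filter.biInter_finset_mem]
      intro i _
      refine (hf.1.iterate i).continuousAt ((isOpen_lt hdc continuous_const).mem_nhds ?_)
      have := hdA _ (iter_inv hAi ha i)
      simp only [mem_setOf_eq, this]; exact hrpos
    obtain ⟨n, -, hn⟩ := mem_om.1 (hAo ha) _ hnb 0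
    have hn' : ∀ i ≤ h, d (f^[i + n] x) < r := by
      intro i hi
      have := mem_iInter₂.1 hn i (Finset.mem_range.2 (by omega))
      rw [mem_preimage, ← iterate_add_apply] at this
      exact this
    have hexi : ∃ e, n ≤ e ∧ r < d (f^[e] x) := by
      refine mem_om.1 hz {v | r < d v} ((isOpen_lt continuous_const hdc).mem_nhds ?_) n
      simp only [mem_setOf_eq]; linarith
    classical
    have hmin := fun m => Nat.find_min hexi (m := m)
    obtain ⟨s1, s2⟩ := Nat.find_spec hexi
    set e := Nat.find hexi
    have hen : n + h < e := by
      by_contra hcon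
      have := hn' (e - n) (by omega)
      rw [show e - n + n = e by omega] at this
      linarith
    refine ⟨e, by omega, s2, fun i hi1 hi2 => ?_⟩
    by_contra hcon
    exact hmin (e - i) (by omega) ⟨by omega, not_le.1 hcon⟩
  choose e he1 he2 he3 using hex
  obtain ⟨y, h1, h2, h3⟩ := back_lim (x := x) hf.1 e he1
  have hy0 : r ≤ d (y 0) := h3 0 {v | r ≤ d v} (isClosed_le continuous_const hdc)
    (Eventually.of_forall fun h => (he2 h).le)
  have hyK : ∀ i, 1 ≤ i → d (y i) ≤ r := fun i hi =>
    h3 i {v | d v ≤ r} (isClosed_le hdc continuous_const)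
      ((eventually_ge_atTop i).mono fun h hh => he3 h i hi hh)
  by_cases hall : ∀ i, IsPeriodicPoint f (y i)
  · obtain ⟨T, hT, hTy⟩ := hall 0
    obtain ⟨j, hj, hjy⟩ := hall T
    have hb := back_iter h1 0 T
    rw [zero_add] at hb
    have e1 : f^[T * j] (y T) = y T := by
      have : IsFixedPt (f^[j]) (y T) := hjy
      have := this.iterate T
      rw [← iterate_mul, mul_comm] at this
      exact this
    have e2 : f^[T * j] (y T) = y 0 := by
      obtain ⟨j, rfl⟩ : ∃ j', j = j' + 1 := ⟨j - 1, by omega⟩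
      rw [mul_add, mul_one, iterate_add_apply, hb, iterate_mul]
      exact IsFixedPt.iterate (f := f^[T]) hTy j
    refine hrper _ (h2 0) (hall 0) (le_antisymm ?_ hy0)
    rw [← e2, e1]
    exact hyK T hT
  · push Not at hall
    obtain ⟨i, hi⟩ := hall
    obtain ⟨N, hN, hKN, hNd, hNF⟩ := fin_nhd hX (isClosed_le hdc (continuous_const (y := r)))
      (isOpen_lt hdc (continuous_const (y := d z / 2)))
      (fun a (ha : d a ≤ r) => show d a < d z / 2 by linarith)
    have hip : ¬ IsPeriodicPoint f (y (i + 1)) := by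
      rintro ⟨T, hT, hTy⟩
      refine hi ⟨T, hT, ?_⟩
      rw [← h1 i, ← iterate_succ_apply, iterate_succ_apply', hTy]
    have hfin := lemE_fwd hX hf (y := fun j => y (j + (i + 1))) (x := x)
      (back_inj (f := f) (fun j => by rw [add_right_comm]; exact h1 _) (by simpa using hip))
      (fun j => by beta_reduce; rw [add_right_comm]; exact h1 _) (fun j => h2 _) hN hNF
      (fun j => hKN (hyK _ (by omega)))
    obtain ⟨b, hb⟩ := hfin.bddAbove
    obtain ⟨k, hk, hkz⟩ := mem_om.1 hz {v | d z / 2 < d v}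
      ((isOpen_lt continuous_const hdc).mem_nhds (by simp only [mem_setOf_eq]; linarith)) (b+1)
    have : k ≤ b := hb (fun h => by
      have : d (f^[k] x) < d z / 2 := hNd h
      have : d z / 2 < d (f^[k] x) := hkz
      linarith)
    omega

lemma per_fin (hX : IsRegCurve X) (hf : IsMonotoneMap f) {N : Set X} (hN : IsOpen N)
    (hF : (frontier N).Finite) {a : X} (ha : a ∈ alphaLimitSet f x) (haN : ∀ i, f^[i] a ∈ N) :
    {v ∈ omegaLimitSet f x | IsPeriodicPoint f v ∧ v ∉ N}.Finite := by
  refine lemP hX hf hN hF ha haN (fun v hv => hv.1) fun S hS => ?_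
  have : ∀ v : X, ∃ T : ℕ, 0 < T ∧ (v ∈ S → f^[T] v = v) := by
    intro v
    by_cases hv : v ∈ S
    · obtain ⟨T, hT, h⟩ := (hS hv).2.1
      exact ⟨T, hT, fun _ => h⟩
    · exact ⟨1, one_pos, fun h => absurd h hv⟩
  choose T hT hTv using this
  refine ⟨∏ v ∈ S, T v, Finset.prod_pos fun v _ => hT v, fun k hk v hv => ⟨v, (hS hv).2.2, ?_⟩⟩
  obtain ⟨c, rfl⟩ := (Finset.dvd_prod_of_mem T hv).trans hk
  rw [iterate_mul]
  exact IsFixedPt.iterate (f := f^[T v]) (hTv v hv) c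

end dyn

end S15

theorem stmt_15 {X : Type*} [MetricSpace X] [CompactSpace X] [ConnectedSpace X]
    (hX : IsRegCurve X) (f : X → X) (hf : IsMonotoneMap f) (x : X)
    (hx : x ∈ ⋂ n : ℕ, Set.range (f^[n]))
    (hinf : (omegaLimitSet f x).Infinite) :
    omegaLimitSet f x = alphaLimitSet f x := by
  have hAc : IsClosed (alphaLimitSet f x ∩ omegaLimitSet f x) := S15.al_closed.inter S15.om_closed
  have hAne : (alphaLimitSet f x ∩ omegaLimitSet f x).Nonempty := by
    by_contra hcon
    obtain ⟨a, ha⟩ := S15.al_nonempty hx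
    obtain ⟨N, hN, hAN, hNo, hF⟩ := S15.fin_nhd hX (S15.al_closed (f := f) (x := x))
      (S15.om_closed (f := f) (x := x)).isOpen_compl
      (fun v hv hv' => hcon ⟨v, hv, hv'⟩)
    refine hinf (S15.lemP hX hf hN hF ha
      (fun i => hAN (S15.iter_inv (fun b hb => S15.al_inv hf.1 hb) ha i)) subset_rfl fun S hS => ?_)
    refine ⟨1, one_pos, fun k _ v hv => ?_⟩
    obtain ⟨v', h1, h2⟩ := S15.om_pre hf.1 (hS hv) k
    exact ⟨v', fun h => hNo h h1, h2⟩
  have hsub : omegaLimitSet f x ⊆ alphaLimitSet f x := by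
    have hAi : ∀ a ∈ alphaLimitSet f x ∩ omegaLimitSet f x, f a ∈ alphaLimitSet f x ∩ omegaLimitSet f x :=
      fun a ha => ⟨S15.al_inv hf.1 ha.1, S15.om_inv hf.1 ha.2⟩
    refine (S15.lemP3 hX hf hAc hAne inter_subset_right hAi fun N hN hAN hF => ?_).trans inter_subset_left
    obtain ⟨a, ha⟩ := hAne
    exact S15.per_fin hX hf hN hF ha.1 fun i => hAN (S15.iter_inv hAi ha i)
  refine Subset.antisymm hsub ?_
  have hnp : ∃ w ∈ omegaLimitSet f x, ¬ IsPeriodicPoint f w := by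
    by_contra! hall
    obtain ⟨a, ha⟩ := hinf.nonempty
    obtain ⟨T, hT, hTa⟩ := hall a ha
    set A : Set X := (fun i => f^[i] a) '' (Set.Iio T) with hA
    have hAfin : A.Finite := (Set.finite_Iio T).image _
    have haA : a ∈ A := ⟨0, hT, rfl⟩
    have hAi : ∀ b ∈ A, f b ∈ A := by
      rintro _ ⟨i, hi, rfl⟩
      have hi : i < T := hi
      by_cases h : i + 1 < T
      · exact ⟨i + 1, h, iterate_succ_apply' f i a⟩
      · have e : i + 1 = T := by omega
        refine ⟨0, hT, ?_⟩
        simp only [iterate_zero, id]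
        rw [← iterate_succ_apply' f, Nat.succ_eq_add_one, e, hTa]
    refine hinf (hAfin.subset (S15.lemP3 hX hf hAfin.isClosed ⟨a, haA⟩ ?_ hAi fun N hN hAN hF => ?_))
    · rintro _ ⟨i, -, rfl⟩
      exact S15.iter_inv (fun b hb => S15.om_inv hf.1 hb) ha i
    · exact S15.per_fin hX hf hN hF (hsub ha) fun i => hAN (S15.iter_inv hAi haA i)
  obtain ⟨w, hw, hwp⟩ := hnp
  obtain ⟨y, h0, h1, h2⟩ := S15.back_orbit hf.1 hw
  have hinj : Injective y := S15.back_inj h1 (by rw [h0]; exact hwp)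
  intro z hz
  by_contra hzo
  obtain ⟨O, V, hO, hV, hoO, hzV, hdis⟩ := (S15.om_closed (f := f) (x := x)).isCompact.separation_of_notMem hzo
  obtain ⟨N, hN, hAN, hNo, hF⟩ := S15.fin_nhd hX (S15.om_closed (f := f) (x := x)) hO hoO
  obtain ⟨b, hb⟩ := (S15.lemE_bwd hX hf hinj h1 h2 hN hF fun i => hAN (h2 i)).bddAbove
  obtain ⟨k, u, hk, hu, hux⟩ := S15.mem_al.1 hz V (hV.mem_nhds hzV) (b + 1)
  have : k ≤ b := hb ⟨u, hux, fun h => Set.disjoint_left.1 hdis (hNo h) hu⟩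
  omega
end
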